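/- arXiv:1905.07038 — 8 statements merged into one kernel-verified Lean document; each statement's English description precedes it below -/
import Mathlib

section
/- Let α > 0 and let f : ℝ → ℝ. Then f dominates some α-Lipschitz function (i.e., there exists an α-Lipschitz g : ℝ → ℝ with g(t) ≤ f(t) for all t ∈ ℝ) if and only if the following three conditions hold: f is bounded below on every compact interval, liminf_{t → −∞} (f(t) − α t) > −∞, and liminf_{t → +∞} (f(t) + α t) > −∞. -/
/-- The `EReal`-valued liminf of a real function is not `⊥` exactly when the function is eventually
bounded below. -/
theorem EReal.bot_lt_liminf_coe_iff {ι : Type*} {l : Filter ι} {u : ι → ℝ} :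
    ⊥ < Filter.liminf (fun i => (u i : EReal)) l ↔ ∃ C : ℝ, ∀ᶠ i in l, C ≤ u i := by
  constructor
  · intro h
    obtain ⟨C, -, hC⟩ := EReal.lt_iff_exists_real_btwn.1 h
    refine ⟨C, (Filter.eventually_lt_of_lt_liminf hC).mono fun i hi => ?_⟩
    exact_mod_cast hi.le
  · rintro ⟨C, hC⟩
    refine (EReal.bot_lt_coe C).trans_le (Filter.le_liminf_of_le (by isBoundedDefault) ?_)
    filter_upwards [hC] with i hi
    exact_mod_cast hi

/-- A function `f : ℝ → ℝ` dominates some `α`-Lipschitz function if and only if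
`f` is bounded below on every compact interval,
`liminf_{t → −∞} (f t − α t) > −∞`, and `liminf_{t → +∞} (f t + α t) > −∞`. -/
theorem lipschitz_minorant_exists_iff (α : ℝ) (hα : 0 < α) (f : ℝ → ℝ) :
    (∃ g : ℝ → ℝ, (∀ s t, |g s - g t| ≤ α * |s - t|) ∧ ∀ t, g t ≤ f t) ↔
      ((∀ a b : ℝ, BddBelow (f '' Set.Icc a b)) ∧
        ⊥ < Filter.liminf (fun t => ((f t - α * t : ℝ) : EReal)) Filter.atBot ∧
        ⊥ < Filter.liminf (fun t => ((f t + α * t : ℝ) : EReal)) Filter.atTop) := by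
  rw [EReal.bot_lt_liminf_coe_iff, EReal.bot_lt_liminf_coe_iff]
  constructor
  · rintro ⟨g, hg, hgf⟩
    have key (t : ℝ) : g 0 - α * |t| ≤ f t := by
      have h := (abs_le.1 (hg t 0)).1
      rw [sub_zero] at h
      linarith [hgf t]
    refine ⟨fun a b => ⟨g 0 - α * max |a| |b|, ?_⟩, ⟨g 0, ?_⟩, ⟨g 0, ?_⟩⟩
    · rintro _ ⟨t, ht, rfl⟩
      have h := mul_le_mul_of_nonneg_left (abs_le_max_abs_abs ht.1 ht.2) hα.le
      linarith [key t]
    · filter_upwards [Filter.eventually_le_atBot 0] with t ht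
      have h := key t
      rw [abs_of_nonpos ht] at h
      linarith
    · filter_upwards [Filter.eventually_ge_atTop 0] with t ht
      have h := key t
      rw [abs_of_nonneg ht] at h
      linarith
  · rintro ⟨hb, ⟨C, hC⟩, ⟨D, hD⟩⟩
    obtain ⟨a, ha⟩ := Filter.eventually_atBot.1 hC
    obtain ⟨b, hb'⟩ := Filter.eventually_atTop.1 hD
    obtain ⟨m, hm⟩ := hb a b
    refine ⟨fun t => min m (min C D) - α * |t|, fun s t => ?_, fun t => ?_⟩
    · rw [sub_sub_sub_cancel_left, ← mul_sub, abs_mul, abs_of_pos hα, abs_sub_comm s t]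
      exact mul_le_mul_of_nonneg_left (abs_abs_sub_abs_le t s) hα.le
    · have hmin := min_le_left m (min C D)
      have hminC := (min_le_right m (min C D)).trans (min_le_left C D)
      have hminD := (min_le_right m (min C D)).trans (min_le_right C D)
      have hpos := mul_le_mul_of_nonneg_left (le_abs_self t) hα.le
      have hneg := mul_le_mul_of_nonneg_left (neg_abs_le t) hα.le
      have habs := mul_nonneg hα.le (abs_nonneg t)
      dsimp only
      rcases le_total t a with h | h
      · linarith [ha t h]
      rcases le_total b t with h' | h'
      · linarith [hb' t h']
      · linarith [hm ⟨t, ⟨h, h'⟩, rfl⟩]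
end

section
/- Let α > 0 and let f : ℝ → ℝ have an α-Lipschitz minorant m. Fix a ∈ ℝ with m(a) = f(a). Define f→ : ℝ → ℝ by f→(t) = f(a) + α(t − a) for t ≤ a and f→(t) = f(t) for t > a. Then f→ has an α-Lipschitz minorant m→, and m(t) = m→(t) for all t ≥ a. -/
/-- `m` is the `α`-Lipschitz minorant of `f`: it is `α`-Lipschitz, dominated by `f`,
and greater than every `α`-Lipschitz function dominated by `f`. -/
def IsLipschitzMinorant (α : ℝ) (f m : ℝ → ℝ) : Prop :=
  (∀ s t, |m s - m t| ≤ α * |s - t|) ∧ (∀ t, m t ≤ f t) ∧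
    ∀ g : ℝ → ℝ, (∀ s t, |g s - g t| ≤ α * |s - t|) → (∀ t, g t ≤ f t) → ∀ t, g t ≤ m t

/-- Two functions that are `α`-Lipschitz and agree at `a` glue to an `α`-Lipschitz function. -/
theorem abs_ite_sub_ite_le_mul {α a : ℝ} {u v : ℝ → ℝ}
    (hu : ∀ s t, |u s - u t| ≤ α * |s - t|) (hv : ∀ s t, |v s - v t| ≤ α * |s - t|)
    (h : u a = v a) (s t : ℝ) :
    |(if s ≤ a then u s else v s) - (if t ≤ a then u t else v t)| ≤ α * |s - t| := by
  have across : ∀ x y, x ≤ a → a ≤ y → |u x - v y| ≤ α * |x - y| := by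
    intro x y hx hy
    have hxa := hu x a
    have hay := hv a y
    rw [abs_of_nonpos (sub_nonpos.2 hx)] at hxa
    rw [abs_of_nonpos (sub_nonpos.2 hy)] at hay
    rw [abs_of_nonpos (sub_nonpos.2 (hx.trans hy))]
    have := abs_sub_le (u x) (v a) (v y)
    rw [h] at hxa
    linarith
  split_ifs with hs ht ht
  · exact hu s t
  · exact across s t hs (not_le.1 ht).le
  · rw [abs_sub_comm, abs_sub_comm s]
    exact across t s ht (not_le.1 hs).le
  · exact hv s t

/-- The pointwise maximum of two `α`-Lipschitz functions is `α`-Lipschitz. -/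
theorem abs_max_sub_max_le_mul {α : ℝ} {u v : ℝ → ℝ}
    (hu : ∀ s t, |u s - u t| ≤ α * |s - t|) (hv : ∀ s t, |v s - v t| ≤ α * |s - t|) (s t : ℝ) :
    |max (u s) (v s) - max (u t) (v t)| ≤ α * |s - t| :=
  (abs_max_sub_max_le_max _ _ _ _).trans (max_le (hu s t) (hv s t))

/-- If `m a = f a` and `f→` replaces `f` on `(-∞, a]` by the line `f a + α (t - a)`,
then `f→` has an `α`-Lipschitz minorant `m→` and `m = m→` on `[a, ∞)`. -/
theorem minorant_forward_replacement (α : ℝ) (hα : 0 < α) (f m : ℝ → ℝ)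
    (hm : IsLipschitzMinorant α f m) (a : ℝ) (ha : m a = f a)
    (fto : ℝ → ℝ)
    (hfto : ∀ t, fto t = if t ≤ a then f a + α * (t - a) else f t) :
    ∃ mto : ℝ → ℝ, IsLipschitzMinorant α fto mto ∧ ∀ t, a ≤ t → m t = mto t := by
  obtain ⟨hLip, hle, hmax⟩ := hm
  have hline : ∀ s t, |(f a + α * (s - a)) - (f a + α * (t - a))| ≤ α * |s - t| := by
    intro s t
    rw [show (f a + α * (s - a)) - (f a + α * (t - a)) = α * (s - t) by ring, abs_mul,
      abs_of_pos hα]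
  refine ⟨fun t => if t ≤ a then f a + α * (t - a) else m t, ⟨?_, ?_, ?_⟩, ?_⟩
  · exact abs_ite_sub_ite_le_mul (u := fun t => f a + α * (t - a)) hline hLip (by simp [ha])
  · intro t
    rw [hfto]
    dsimp only
    split_ifs
    · exact le_rfl
    · exact hle t
  · intro g hg hgf t
    have hga : g a ≤ m a := by simpa [hfto, ha] using hgf a
    by_cases ht : t ≤ a
    · simpa [hfto, ht] using hgf t
    · have hle_max : ∀ x, (if x ≤ a then m x else max (g x) (m x)) ≤ f x := by
        intro x
        split_ifs with hx
        · exact hle x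
        · exact max_le (by simpa [hfto, hx] using hgf x) (hle x)
      have hmax_le := hmax _ (abs_ite_sub_ite_le_mul (v := fun x => max (g x) (m x)) hLip
        (abs_max_sub_max_le_mul hg hLip) (max_eq_right hga).symm) hle_max t
      simp only [if_neg ht] at hmax_le ⊢
      exact (le_max_left _ _).trans hmax_le
  · intro t ht
    dsimp only
    split_ifs with h
    · rw [le_antisymm h ht, ha]
      ring
    · rfl
end

section
/- Let α > 0 and let f : ℝ → ℝ be càdlàg with an α-Lipschitz minorant m : ℝ → ℝ. Then: (a) the set {t ∈ ℝ : m(t) = f(t) ∧ f(t−)} is closed; and (b) if t' < t'' are such that f(t') ∧ f(t'−) = m(t'), f(t'') ∧ f(t''−) = m(t''), and f(t) ∧ f(t−) > m(t) for all t' < t < t'', then, setting t* = (f(t'') ∧ f(t''−) − f(t') ∧ f(t'−) + α(t'' + t'))/(2α), one has m(t) = f(t') ∧ f(t'−) + α(t − t') for t' ≤ t ≤ t*, and m(t) = f(t'') ∧ f(t''−) + α(t'' − t) for t* ≤ t ≤ t''. -/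
open Filter Topology

theorem lowerSemicontinuous_min_leftLim {f fl : ℝ → ℝ}
    (hrc : ∀ t : ℝ, ContinuousWithinAt f (Set.Ici t) t)
    (hll : ∀ t : ℝ, Tendsto f (𝓝[<] t) (𝓝 (fl t))) :
    LowerSemicontinuous fun t => min (f t) (fl t) := by
  intro t c hc
  obtain ⟨d, hcd, hd⟩ := exists_between hc
  have hnear : ∀ᶠ s in 𝓝 t, d < f s := by
    rw [← nhdsLT_sup_nhdsGE, eventually_sup]
    exact ⟨(hll t).eventually_const_lt (lt_min_iff.1 hd).2,
      (hrc t).eventually_const_lt (lt_min_iff.1 hd).1⟩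
  filter_upwards [eventually_eventually_nhds.2 hnear] with s hs
  refine hcd.trans_le (le_min hs.self_of_nhds.le (ge_of_tendsto (hll s) ?_))
  exact (hs.filter_mono nhdsWithin_le_nhds).mono fun _ h => h.le

theorem IsLipschitzMinorant.le_min_leftLim {α : ℝ} {f fl m : ℝ → ℝ}
    (hm : IsLipschitzMinorant α f m) (hcont : Continuous m)
    (hll : ∀ t : ℝ, Tendsto f (𝓝[<] t) (𝓝 (fl t))) (t : ℝ) :
    m t ≤ min (f t) (fl t) :=
  le_min (hm.2.1 t) <| le_of_tendsto_of_tendsto'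
    (hcont.continuousAt.mono_left nhdsWithin_le_nhds) (hll t) hm.2.1

theorem IsLipschitzMinorant.continuous {α : ℝ} {f m : ℝ → ℝ}
    (hm : IsLipschitzMinorant α f m) : Continuous m := by
  refine (LipschitzWith.of_dist_le_mul (K := α.toNNReal) fun s t => ?_).continuous
  rw [Real.dist_eq, Real.dist_eq]
  exact (hm.1 s t).trans (mul_le_mul_of_nonneg_right (Real.le_coe_toNNReal α) (abs_nonneg _))

/-- A lower cone with apex `(t₀, c)` lying below `f ∨ m` has its apex below `m`. -/
theorem IsLipschitzMinorant.le_of_cone_le {α : ℝ} (hα : 0 ≤ α) {f m : ℝ → ℝ}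
    (hm : IsLipschitzMinorant α f m) {t₀ c : ℝ}
    (hc : ∀ s, c - α * |s - t₀| ≤ m s ∨ c - α * |s - t₀| ≤ f s) : c ≤ m t₀ := by
  have key := hm.2.2 (fun s => max (m s) (c - α * |s - t₀|)) (fun s t => ?_) (fun s => ?_) t₀
  · simpa using key
  · refine (abs_max_sub_max_le_max _ _ _ _).trans (max_le (hm.1 s t) ?_)
    have h := abs_abs_sub_abs_le (t - t₀) (s - t₀)
    rw [sub_sub_sub_cancel_right, abs_sub_comm t s] at h
    calc |c - α * |s - t₀| - (c - α * |t - t₀|)| = α * |(|t - t₀| - |s - t₀|)| := by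
          rw [sub_sub_sub_cancel_left, ← mul_sub, abs_mul, abs_of_nonneg hα]
      _ ≤ α * |s - t| := mul_le_mul_of_nonneg_left h hα
  · exact max_le (hm.2.1 s) ((hc s).elim (fun h => h.trans (hm.2.1 s)) id)

/-- On an interval whose interior has no contact point, the minorant is the largest
`α`-Lipschitz function with the given boundary values. -/
theorem IsLipschitzMinorant.eq_min_of_no_contact {α : ℝ} (hα : 0 ≤ α) {f F m : ℝ → ℝ}
    (hm : IsLipschitzMinorant α f m) (hF : LowerSemicontinuous F) (hFf : ∀ t, F t ≤ f t)
    (hmF : ∀ t, m t ≤ F t) {a b : ℝ} (hlt : ∀ t, a < t → t < b → m t < F t)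
    {t : ℝ} (hat : a ≤ t) (htb : t ≤ b) :
    m t = min (m a + α * (t - a)) (m b + α * (b - t)) := by
  have hlip : ∀ s u, m s ≤ m u + α * |s - u| := fun s u => by
    linarith [(abs_le.1 (hm.1 s u)).2]
  have hle : m t ≤ min (m a + α * (t - a)) (m b + α * (b - t)) := by
    refine le_min ?_ ?_
    · simpa [abs_of_nonneg (sub_nonneg.2 hat)] using hlip t a
    · simpa [abs_sub_comm t b, abs_of_nonneg (sub_nonneg.2 htb)] using hlip t b
  refine hle.antisymm (le_of_not_gt fun hgt => ?_)
  obtain ⟨hgta, hgtb⟩ := lt_min_iff.1 hgt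
  have hlsc : LowerSemicontinuous fun s => F s + α * |s - t| :=
    hF.add (by fun_prop : Continuous fun s : ℝ => α * |s - t|).lowerSemicontinuous
  obtain ⟨s₀, hs₀, hmin⟩ := (hlsc.lowerSemicontinuousOn _).exists_isMinOn
    (Set.nonempty_Icc.2 (hat.trans htb)) isCompact_Icc
  have hv : m t < F s₀ + α * |s₀ - t| := by
    rcases hs₀.1.eq_or_lt with rfl | h1
    · rw [abs_sub_comm, abs_of_nonneg (sub_nonneg.2 hat)]
      linarith [hmF a]
    rcases hs₀.2.eq_or_lt with rfl | h2
    · rw [abs_of_nonneg (sub_nonneg.2 htb)]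
      linarith [hmF s₀]
    · rw [abs_sub_comm]
      linarith [hlip t s₀, hlt s₀ h1 h2]
  obtain ⟨c, hmc, hc⟩ := exists_between (lt_min hv hgt)
  obtain ⟨hcv, hch⟩ := lt_min_iff.1 hc
  obtain ⟨hca, hcb⟩ := lt_min_iff.1 hch
  refine hmc.not_ge (hm.le_of_cone_le hα fun s => ?_)
  rcases lt_or_ge s a with hsa | hsa
  · left
    have h := hlip a s
    rw [abs_of_nonneg (by linarith)] at h
    rw [abs_of_nonpos (by linarith)]
    linarith
  rcases lt_or_ge b s with hsb | hsb
  · left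
    have h := hlip b s
    rw [abs_of_nonpos (by linarith)] at h
    rw [abs_of_nonneg (by linarith)]
    linarith
  · right
    have h : F s₀ + α * |s₀ - t| ≤ F s + α * |s - t| := hmin ⟨hsa, hsb⟩
    linarith [hFf s]

/-- For a càdlàg `f` (with left limits `fl`) with `α`-Lipschitz minorant `m`:
(a) the contact set `{t : m t = f t ∧ f(t−)}` is closed; (b) between two consecutive
contact points `t' < t''` the minorant is the sawtooth rising with slope `α` from `t'` up
to `t* = (f t'' ∧ f(t''−) − f t' ∧ f(t'−) + α (t'' + t'))/(2α)` and falling with slope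
`−α` from `t*` to `t''`. -/
theorem contact_set_closed_and_sawtooth (α : ℝ) (hα : 0 < α) (f fl m : ℝ → ℝ)
    (hrc : ∀ t : ℝ, ContinuousWithinAt f (Set.Ici t) t)
    (hll : ∀ t : ℝ, Filter.Tendsto f (nhdsWithin t (Set.Iio t)) (nhds (fl t)))
    (hm : IsLipschitzMinorant α f m) :
    IsClosed {t : ℝ | m t = min (f t) (fl t)} ∧
    ∀ t' t'' : ℝ, t' < t'' →
      min (f t') (fl t') = m t' → min (f t'') (fl t'') = m t'' →
      (∀ t, t' < t → t < t'' → m t < min (f t) (fl t)) →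
      ∀ tstar : ℝ,
        tstar = (min (f t'') (fl t'') - min (f t') (fl t') + α * (t'' + t')) / (2 * α) →
        (∀ t, t' ≤ t → t ≤ tstar → m t = min (f t') (fl t') + α * (t - t')) ∧
        (∀ t, tstar ≤ t → t ≤ t'' → m t = min (f t'') (fl t'') + α * (t'' - t)) := by
  have hF := lowerSemicontinuous_min_leftLim hrc hll
  have hmF := hm.le_min_leftLim hm.continuous hll
  refine ⟨?_, ?_⟩
  · have hlsc : LowerSemicontinuous fun t => min (f t) (fl t) + -m t :=
      hF.add hm.continuous.neg.lowerSemicontinuous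
    convert hlsc.isClosed_preimage 0 using 1
    ext t
    simp only [Set.mem_ofPred_eq, Set.mem_preimage, Set.mem_Iic]
    exact ⟨fun h => by linarith, fun h => (hmF t).antisymm (by linarith)⟩
  · intro a b hab ha hb hlt tstar htstar
    rw [ha, hb] at htstar ⊢
    rw [eq_div_iff (by positivity)] at htstar
    have hLip := abs_le.1 (hm.1 b a)
    rw [abs_of_pos (sub_pos.2 hab)] at hLip
    have hastar : a ≤ tstar := by
      by_contra! h
      nlinarith [mul_lt_mul_of_pos_left h hα]
    have hstarb : tstar ≤ b := by
      by_contra! h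
      nlinarith [mul_lt_mul_of_pos_left h hα]
    have hsaw : ∀ t, a ≤ t → t ≤ b → m t = min (m a + α * (t - a)) (m b + α * (b - t)) :=
      fun t => hm.eq_min_of_no_contact hα.le hF (fun t => min_le_left _ _) hmF hlt
    refine ⟨fun t h1 h2 => ?_, fun t h1 h2 => ?_⟩
    · rw [hsaw t h1 (h2.trans hstarb)]
      exact min_eq_left (by linarith [mul_le_mul_of_nonneg_left h2 hα.le])
    · rw [hsaw t (hastar.trans h1) h2]
      exact min_eq_right (by linarith [mul_le_mul_of_nonneg_left h1 hα.le])
end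

section
/- Let (K, P) be a stationary random element of H × L. Then the random variable U_0 = −P_{−1}/(P_0 − P_{−1}) is uniformly distributed on [0, 1) and is independent of (K°, P°). Moreover, for every t > 0, every nonnegative Borel function g on [0, 1), and every nonnegative measurable function f on H × L, one has t · E[g(U_0) f(K°, P°)/l_0] = (∫_0^1 g(x) dx) · E[Σ_{k=1}^{N_t} f(θ_{P_k}(K, P))], where l_0 = P_0 − P_{−1}. -/
open MeasureTheory ProbabilityTheory
open scoped ENNReal

/-- The set `H` of càdlàg real paths indexed by `ℝ` vanishing at `0`. -/
def pathSpace : Set (ℝ → ℝ) :=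
  {z | z 0 = 0 ∧ (∀ t : ℝ, ContinuousWithinAt z (Set.Ici t) t) ∧
      ∀ t : ℝ, ∃ l : ℝ, Filter.Tendsto z (nhdsWithin t (Set.Iio t)) (nhds l)}

/-- The set `L` of strictly increasing two-sided real sequences with `s₋₁ < 0 ≤ s₀`,
tending to `−∞` at `−∞` and to `+∞` at `+∞`. -/
def seqSpace : Set (ℤ → ℝ) :=
  {s | StrictMono s ∧ s (-1) < 0 ∧ 0 ≤ s 0 ∧
      Filter.Tendsto s Filter.atBot Filter.atBot ∧ Filter.Tendsto s Filter.atTop Filter.atTop}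

/-- `nIdx s t` is the index `n` with `t ∈ [s (n-1), s n)` (for `s ∈ seqSpace`). -/
noncomputable def nIdx (s : ℤ → ℝ) (t : ℝ) : ℤ := sInf {n : ℤ | t < s n}

/-- The shift `θ_t` on `H × L`. -/
noncomputable def shift (t : ℝ) (p : (ℝ → ℝ) × (ℤ → ℝ)) : (ℝ → ℝ) × (ℤ → ℝ) :=
  (fun u => p.1 (t + u) - p.1 t, fun k => p.2 (nIdx p.2 t + k) - t)

theorem nIdx_isLeast {s : ℤ → ℝ} (hs : s ∈ seqSpace) (t : ℝ) :
    IsLeast {n : ℤ | t < s n} (nIdx s t) := by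
  obtain ⟨hmono, -, -, hbot, htop⟩ := hs
  obtain ⟨a, ha⟩ := (hbot.eventually (Filter.eventually_le_atBot t)).exists
  obtain ⟨b, hb⟩ := (htop.eventually (Filter.eventually_gt_atTop t)).exists
  obtain ⟨n, hn, hmin⟩ := Int.exists_least_of_bdd (P := fun n => t < s n)
    ⟨a, fun z hz => (hmono.lt_iff_lt.1 (ha.trans_lt hz)).le⟩ ⟨b, hb⟩
  have hleast : IsLeast {n : ℤ | t < s n} n := ⟨hn, hmin⟩
  rwa [nIdx, hleast.csInf_eq]

theorem lt_nIdx {s : ℤ → ℝ} (hs : s ∈ seqSpace) (t : ℝ) : t < s (nIdx s t) :=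
  (nIdx_isLeast hs t).1

theorem nIdx_le_iff {s : ℤ → ℝ} (hs : s ∈ seqSpace) (t : ℝ) (n : ℤ) :
    nIdx s t ≤ n ↔ t < s n :=
  ⟨fun h => (lt_nIdx hs t).trans_le (hs.1.monotone h), fun h => (nIdx_isLeast hs t).2 h⟩

theorem nIdx_eq_of_mem_Ico {s : ℤ → ℝ} (hs : StrictMono s) {t : ℝ} {n : ℤ}
    (ht : t ∈ Set.Ico (s (n - 1)) (s n)) : nIdx s t = n := by
  refine IsLeast.csInf_eq ⟨ht.2, fun m hm => ?_⟩
  have := hs.lt_iff_lt.1 (ht.1.trans_lt hm)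
  lia

theorem nIdx_nonneg {s : ℤ → ℝ} (hs : s ∈ seqSpace) {t : ℝ} (ht : 0 ≤ t) : 0 ≤ nIdx s t := by
  have := hs.1.lt_iff_lt.1 ((hs.2.1.trans_le ht).trans (lt_nIdx hs t))
  lia

/-- A function that selects among countably many measurable functions by a measurable index is
measurable. -/
theorem measurable_countable_select {ι α β : Type*} [Countable ι] [MeasurableSpace ι]
    [MeasurableSingletonClass ι] [MeasurableSpace α] [MeasurableSpace β] {h : ι → α → β}
    (hh : ∀ i, Measurable (h i)) {n : α → ι} (hn : Measurable n) :
    Measurable fun a => h (n a) a :=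
  (measurable_from_prod_countable_right (f := fun p : ι × α => h p.1 p.2) hh).comp
    (hn.prodMk measurable_id)

/-- The upper limit of a path along a sequence of rational times decreasing to `t`. It is jointly
measurable in the path and the time, and it is the value at `t` of a right-continuous path. -/
noncomputable def rightValue (z : ℝ → ℝ) (t : ℝ) : ℝ :=
  Filter.limsup (fun n : ℕ => z ((⌊t * (n + 1)⌋ + 1 : ℤ) / ((n : ℝ) + 1))) Filter.atTop

theorem rightValue_eq {z : ℝ → ℝ} {t : ℝ} (hz : ContinuousWithinAt z (Set.Ici t) t) :
    rightValue z t = z t := by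
  refine Filter.Tendsto.limsup_eq (hz.tendsto.comp ?_)
  have hlow (n : ℕ) : t ≤ (⌊t * (n + 1)⌋ + 1 : ℤ) / ((n : ℝ) + 1) := by
    rw [le_div_iff₀ (by positivity)]
    push_cast
    exact (Int.lt_floor_add_one _).le
  have hupp (n : ℕ) : (⌊t * (n + 1)⌋ + 1 : ℤ) / ((n : ℝ) + 1) ≤ t + 1 / ((n : ℝ) + 1) := by
    rw [div_le_iff₀ (by positivity), add_mul, one_div, inv_mul_cancel₀ (by positivity)]
    push_cast
    linarith [Int.floor_le (t * ((n : ℝ) + 1))]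
  refine tendsto_nhdsWithin_iff.2 ⟨?_, .of_forall hlow⟩
  refine tendsto_of_tendsto_of_tendsto_of_le_of_le tendsto_const_nhds ?_ hlow hupp
  simpa using tendsto_const_nhds.add (tendsto_one_div_add_atTop_nhds_zero_nat (𝕜 := ℝ))

theorem measurable_rightValue : Measurable fun p : (ℝ → ℝ) × ℝ => rightValue p.1 p.2 := by
  refine Measurable.limsup fun n => ?_
  refine measurable_countable_select (ι := ℤ)
    (h := fun m (p : (ℝ → ℝ) × ℝ) => p.1 ((m : ℝ) / ((n : ℝ) + 1))) (fun m => ?_)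
    (n := fun p => ⌊p.2 * (n + 1)⌋ + 1) ?_
  · exact (measurable_pi_apply _).comp measurable_fst
  · exact ((Int.measurable_floor.comp (measurable_snd.mul_const _))).add_const 1

/-- A version, measurable on the whole product space, of the shift by the `k`-th point. -/
noncomputable def pointShift (k : ℤ) (p : (ℝ → ℝ) × (ℤ → ℝ)) : (ℝ → ℝ) × (ℤ → ℝ) :=
  (fun u => rightValue p.1 (p.2 k + u) - rightValue p.1 (p.2 k), fun j => p.2 (k + 1 + j) - p.2 k)

theorem measurable_pointShift (k : ℤ) : Measurable (pointShift k) := by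
  have hk (j : ℤ) : Measurable fun p : (ℝ → ℝ) × (ℤ → ℝ) => p.2 j :=
    (measurable_pi_apply j).comp measurable_snd
  have hval {τ : (ℝ → ℝ) × (ℤ → ℝ) → ℝ} (hτ : Measurable τ) :
      Measurable fun p : (ℝ → ℝ) × (ℤ → ℝ) => rightValue p.1 (τ p) :=
    Measurable.comp (g := fun p : (ℝ → ℝ) × ℝ => rightValue p.1 p.2)
      (f := fun p : (ℝ → ℝ) × (ℤ → ℝ) => (p.1, τ p)) measurable_rightValue
      (measurable_fst.prodMk hτ)
  refine Measurable.prodMk (measurable_pi_lambda _ fun u => ?_) (measurable_pi_lambda _ fun j => ?_)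
  · exact (hval ((hk k).add_const u)).sub (hval (hk k))
  · exact (hk _).sub (hk _)

theorem pointShift_eq_shift {p : (ℝ → ℝ) × (ℤ → ℝ)} (hz : p.1 ∈ pathSpace) (hs : p.2 ∈ seqSpace)
    (k : ℤ) : pointShift k p = shift (p.2 k) p := by
  have hn : nIdx p.2 (p.2 k) = k + 1 :=
    nIdx_eq_of_mem_Ico hs.1 ⟨by simp, hs.1 (lt_add_one k)⟩
  simp only [pointShift, shift, rightValue_eq (hz.2.1 _), hn]

theorem pointShift_shift {p : (ℝ → ℝ) × (ℤ → ℝ)} (hz : p.1 ∈ pathSpace) (t : ℝ) (k : ℤ) :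
    pointShift k (shift t p) = pointShift (nIdx p.2 t + k) p := by
  have hc (u : ℝ) : ContinuousWithinAt (fun u => p.1 (t + u) - p.1 t) (Set.Ici u) u := by
    refine ContinuousWithinAt.sub ?_ continuousWithinAt_const
    refine (hz.2.1 (t + u)).comp (by fun_prop) fun v hv => ?_
    simpa using hv
  simp only [pointShift, shift, rightValue_eq (hz.2.1 _), rightValue_eq (hc _)]
  refine Prod.ext (funext fun u => ?_) (funext fun j => ?_)
  · dsimp only
    rw [sub_sub_sub_cancel_right, add_sub_cancel, ← add_assoc, add_sub_cancel]
  · simp [add_assoc]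

/-- The integrand `g(U) f(θ) / l` evaluated on the cell `[s (k - 1), s k)` at time `t`. -/
noncomputable def cellWeight (g : ℝ → ℝ≥0∞) (f : (ℝ → ℝ) × (ℤ → ℝ) → ℝ≥0∞) (k : ℤ) (t : ℝ)
    (p : (ℝ → ℝ) × (ℤ → ℝ)) : ℝ≥0∞ :=
  g ((t - p.2 (k - 1)) / (p.2 k - p.2 (k - 1))) * f (pointShift k p) /
    ENNReal.ofReal (p.2 k - p.2 (k - 1))

section cellWeight

variable {g : ℝ → ℝ≥0∞} {f : (ℝ → ℝ) × (ℤ → ℝ) → ℝ≥0∞}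

theorem measurable_cellWeight (hg : Measurable g) (hf : Measurable f) (k : ℤ) :
    Measurable fun q : ℝ × ((ℝ → ℝ) × (ℤ → ℝ)) => cellWeight g f k q.1 q.2 := by
  have hk (j : ℤ) : Measurable fun q : ℝ × ((ℝ → ℝ) × (ℤ → ℝ)) => q.2.2 j :=
    (measurable_pi_apply j).comp (measurable_snd.comp measurable_snd)
  have hA : Measurable fun q : ℝ × ((ℝ → ℝ) × (ℤ → ℝ)) => pointShift k q.2 :=
    (measurable_pointShift k).comp measurable_snd
  exact ((hg.comp ((measurable_fst.sub (hk _)).div ((hk _).sub (hk _)))).mul (hf.comp hA)).div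
    ((hk _).sub (hk _)).ennreal_ofReal

theorem measurable_cellWeight_right (hg : Measurable g) (hf : Measurable f) (k : ℤ) (t : ℝ) :
    Measurable (cellWeight g f k t) :=
  (measurable_cellWeight hg hf k).comp measurable_prodMk_left

theorem cellWeight_shift {p : (ℝ → ℝ) × (ℤ → ℝ)} (hz : p.1 ∈ pathSpace) (s t : ℝ) :
    cellWeight g f 0 s (shift t p) = cellWeight g f (nIdx p.2 t) (s + t) p := by
  simp only [cellWeight, pointShift_shift hz]
  simp only [shift, add_zero, zero_sub, sub_sub_sub_cancel_right, ← sub_eq_add_neg]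
  rw [sub_sub_eq_add_sub]

theorem lintegral_cellWeight (hg : Measurable g) {p : (ℝ → ℝ) × (ℤ → ℝ)}
    (hs : StrictMono p.2) (k : ℤ) :
    ∫⁻ t in Set.Ico (p.2 (k - 1)) (p.2 k), cellWeight g f k t p =
      (∫⁻ x in Set.Ico (0 : ℝ) 1, g x) * f (pointShift k p) := by
  set a := p.2 (k - 1) with ha
  set l := p.2 k - a with hl
  have hl0 : 0 < l := sub_pos.2 (hs (by lia))
  have hlE : ENNReal.ofReal l ≠ 0 := by simpa using hl0
  have himage : (fun x => l * x + a) '' Set.Ico (0 : ℝ) 1 = Set.Ico a (p.2 k) := by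
    rw [Set.image_affine_Ico hl0]
    simp [hl]
  have hcv := lintegral_image_eq_lintegral_abs_deriv_mul (s := Set.Ico (0 : ℝ) 1)
    (f := fun x => l * x + a) (f' := fun _ => l) measurableSet_Ico
    (fun x _ => by simpa using (((hasDerivAt_id x).const_mul l).add_const a).hasDerivWithinAt)
    (fun x _ y _ h => by simpa [hl0.ne'] using h) (fun t => cellWeight g f k t p)
  rw [← himage, hcv, ← lintegral_mul_const _ hg]
  refine lintegral_congr fun x => ?_
  simp only [cellWeight, ← ha, ← hl, abs_of_pos hl0, add_sub_cancel_right,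
    mul_div_cancel_left₀ x hl0.ne']
  exact ENNReal.mul_div_cancel hlE ENNReal.ofReal_ne_top

theorem lintegral_Ico_zero_cellWeight (hg : Measurable g) {p : (ℝ → ℝ) × (ℤ → ℝ)}
    (hs : p.2 ∈ seqSpace) (n : ℕ) :
    ∫⁻ t in Set.Ico 0 (p.2 n), cellWeight g f (nIdx p.2 t) t p =
      (∫⁻ x in Set.Ico (0 : ℝ) 1, g x) * ∑ k ∈ Finset.Icc (1 : ℤ) n, f (pointShift k p) +
        ∫⁻ t in Set.Ico 0 (p.2 0), cellWeight g f 0 t p := by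
  have hcell (a : ℝ) (k : ℤ) (ha : p.2 (k - 1) ≤ a) :
      ∫⁻ t in Set.Ico a (p.2 k), cellWeight g f (nIdx p.2 t) t p =
        ∫⁻ t in Set.Ico a (p.2 k), cellWeight g f k t p :=
    setLIntegral_congr_fun measurableSet_Ico fun t ht => by
      simp only [nIdx_eq_of_mem_Ico hs.1 ⟨ha.trans ht.1, ht.2⟩]
  induction n with
  | zero => simpa using hcell 0 0 (by simpa using hs.2.1.le)
  | succ n ih =>
    have hle : p.2 n ≤ p.2 (n + 1 : ℕ) := hs.1.monotone (by simp)
    have h0 : 0 ≤ p.2 n := hs.2.2.1.trans (hs.1.monotone (by simp))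
    have hIcc : Finset.Icc (1 : ℤ) (n + 1 : ℕ) = insert ((n + 1 : ℕ) : ℤ) (Finset.Icc 1 (n : ℤ)) := by
      ext k
      simp only [Finset.mem_Icc, Finset.mem_insert]
      lia
    have hlast := lintegral_cellWeight (f := f) hg hs.1 ((n + 1 : ℕ) : ℤ)
    rw [show ((n + 1 : ℕ) : ℤ) - 1 = n by simp] at hlast
    rw [← Set.Ico_union_Ico_eq_Ico h0 hle,
      lintegral_union measurableSet_Ico (Set.Ico_disjoint_Ico_same), ih,
      hcell _ _ (by simp), hlast, hIcc, Finset.sum_insert (by simp)]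
    ring

/-- The integral of the cell weight over the part of the central cell lying after time `0`. -/
noncomputable def residualWeight (g : ℝ → ℝ≥0∞) (f : (ℝ → ℝ) × (ℤ → ℝ) → ℝ≥0∞)
    (p : (ℝ → ℝ) × (ℤ → ℝ)) : ℝ≥0∞ :=
  ∫⁻ s in Set.Ico 0 (p.2 0), cellWeight g f 0 s p

theorem measurable_residualWeight (hg : Measurable g) (hf : Measurable f) :
    Measurable (residualWeight g f) := by
  have hm : Measurable fun q : ((ℝ → ℝ) × (ℤ → ℝ)) × ℝ =>
      {q : ((ℝ → ℝ) × (ℤ → ℝ)) × ℝ | q.2 ∈ Set.Ico 0 (q.1.2 0)}.indicator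
        (fun q => cellWeight g f 0 q.2 q.1) q := by
    refine ((measurable_cellWeight hg hf 0).comp measurable_swap).indicator ?_
    exact (measurableSet_le measurable_const measurable_snd).inter (measurableSet_lt measurable_snd
      ((measurable_pi_apply 0).comp (measurable_snd.comp measurable_fst)))
  convert hm.lintegral_prod_right' (ν := volume) using 2 with p
  simp only [residualWeight]
  rw [← lintegral_indicator measurableSet_Ico]
  rfl

theorem residualWeight_le (hg : Measurable g) {p : (ℝ → ℝ) × (ℤ → ℝ)} (hs : p.2 ∈ seqSpace) :
    residualWeight g f p ≤ (∫⁻ x in Set.Ico (0 : ℝ) 1, g x) * f (pointShift 0 p) := by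
  rw [← lintegral_cellWeight hg hs.1 0]
  exact lintegral_mono_set (Set.Ico_subset_Ico_left (by simpa using hs.2.1.le))

theorem lintegral_shift_add_residualWeight (hg : Measurable g) {p : (ℝ → ℝ) × (ℤ → ℝ)}
    (hz : p.1 ∈ pathSpace) (hs : p.2 ∈ seqSpace) {t : ℝ} (ht : 0 ≤ t) :
    (∫⁻ s in Set.Ico 0 t, cellWeight g f 0 0 (shift s p)) + residualWeight g f (shift t p) =
      (∫⁻ x in Set.Ico (0 : ℝ) 1, g x) *
        ∑ k ∈ Finset.Icc (1 : ℤ) (nIdx p.2 t), f (pointShift k p) + residualWeight g f p := by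
  obtain ⟨n, hn⟩ := Int.eq_ofNat_of_zero_le (nIdx_nonneg hs ht)
  have htn : t < p.2 n := hn ▸ lt_nIdx hs t
  have hlow : p.2 (n - 1) ≤ t := by
    by_contra! h
    have := (nIdx_le_iff hs t _).2 h
    lia
  have htail : residualWeight g f (shift t p) =
      ∫⁻ s in Set.Ico t (p.2 n), cellWeight g f (nIdx p.2 s) s p := by
    have hend : (shift t p).2 0 = p.2 n - t := by simp [shift, hn]
    have htrans := (measurePreserving_add_right volume t).setLIntegral_comp_emb
      (MeasurableEquiv.addRight t).measurableEmbedding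
      (fun s => cellWeight g f n s p) (Set.Ico 0 (p.2 n - t))
    simp only [Set.image_add_const_Ico, zero_add, sub_add_cancel] at htrans
    simp only [residualWeight, hend, cellWeight_shift hz, hn]
    rw [htrans]
    refine setLIntegral_congr_fun measurableSet_Ico fun s hs' => ?_
    simp only [nIdx_eq_of_mem_Ico hs.1 ⟨hlow.trans hs'.1, hs'.2⟩]
  rw [htail, hn, residualWeight, ← lintegral_Ico_zero_cellWeight hg hs n,
    ← Set.Ico_union_Ico_eq_Ico ht htn.le,
    lintegral_union measurableSet_Ico Set.Ico_disjoint_Ico_same]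
  simp only [cellWeight_shift hz, zero_add]

end cellWeight

theorem iSup_mul_iSup_of_monotone {u v : ℕ → ℝ≥0∞} (hu : Monotone u) (hv : Monotone v) :
    (⨆ n, u n) * ⨆ n, v n = ⨆ n, u n * v n := by
  refine le_antisymm ?_ ENNReal.iSup_mul_le
  simp only [ENNReal.iSup_mul, ENNReal.mul_iSup]
  exact iSup₂_le fun n m => le_iSup_of_le (max m n)
    (mul_le_mul' (hu (le_max_left m n)) (hv (le_max_right m n)))

theorem iSup_min_natCast (a : ℝ≥0∞) : ⨆ n : ℕ, min a n = a := by
  simp [← inf_iSup_eq, ENNReal.iSup_natCast]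

section stationary

variable {Ω : Type*} [MeasurableSpace Ω] {μ : Measure Ω} [IsProbabilityMeasure μ]
  {X : Ω → (ℝ → ℝ) × (ℤ → ℝ)} {g : ℝ → ℝ≥0∞} {f : (ℝ → ℝ) × (ℤ → ℝ) → ℝ≥0∞}

theorem measurable_nIdx (hX : Measurable X) (hmem : ∀ ω, (X ω).2 ∈ seqSpace) :
    Measurable fun q : ℝ × Ω => nIdx (X q.2).2 q.1 := by
  refine measurable_of_Iic fun n => ?_
  simp only [Set.preimage, Set.mem_Iic, nIdx_le_iff (hmem _)]
  exact measurableSet_lt measurable_fst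
    ((measurable_pi_apply n).comp (measurable_snd.comp (hX.comp measurable_snd)))

theorem measurable_sum_pointShift (hX : Measurable X) (hmem : ∀ ω, (X ω).2 ∈ seqSpace)
    (hf : Measurable f) (t : ℝ) :
    Measurable fun ω => ∑ k ∈ Finset.Icc (1 : ℤ) (nIdx (X ω).2 t), f (pointShift k (X ω)) :=
  measurable_countable_select (ι := ℤ)
    (h := fun n ω => ∑ k ∈ Finset.Icc (1 : ℤ) n, f (pointShift k (X ω)))
    (fun _ => Finset.measurable_sum _ fun k _ => hf.comp ((measurable_pointShift k).comp hX))
    ((measurable_nIdx hX hmem).comp measurable_prodMk_left)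

theorem lintegral_comp_shift (hX : Measurable X)
    (hstat : ∀ s : ℝ, μ.map (fun ω => shift s (X ω)) = μ.map X)
    {F : (ℝ → ℝ) × (ℤ → ℝ) → ℝ≥0∞} (hF : Measurable F) (s : ℝ) :
    ∫⁻ ω, F (shift s (X ω)) ∂μ = ∫⁻ ω, F (X ω) ∂μ := by
  have hae : AEMeasurable (fun ω => shift s (X ω)) μ := by
    by_contra h
    have hprob := Measure.isProbabilityMeasure_map (μ := μ) hX.aemeasurable
    rw [← hstat s, Measure.map_of_not_aemeasurable h] at hprob
    exact hprob.ne_zero _ rfl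
  rw [← lintegral_map' hF.aemeasurable hae, hstat s, lintegral_map hF hX]

theorem measurable_uncurry_cellWeight_shift (hX : Measurable X)
    (hpath : ∀ ω, (X ω).1 ∈ pathSpace) (hseq : ∀ ω, (X ω).2 ∈ seqSpace)
    (hg : Measurable g) (hf : Measurable f) :
    Measurable (Function.uncurry fun ω s => cellWeight g f 0 0 (shift s (X ω))) := by
  have hjoint : Measurable fun q : ℝ × Ω => cellWeight g f (nIdx (X q.2).2 q.1) q.1 (X q.2) :=
    measurable_countable_select (ι := ℤ)
      (h := fun k (q : ℝ × Ω) => cellWeight g f k q.1 (X q.2))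
      (fun k => (measurable_cellWeight hg hf k).comp
        (measurable_fst.prodMk (hX.comp measurable_snd))) (measurable_nIdx hX hseq)
  simp only [cellWeight_shift (hpath _), zero_add]
  exact hjoint.comp measurable_swap

/-- The Campbell-type identity for bounded `f` and `g`. -/
theorem lintegral_cellWeight_of_bounded (hX : Measurable X)
    (hpath : ∀ ω, (X ω).1 ∈ pathSpace) (hseq : ∀ ω, (X ω).2 ∈ seqSpace)
    (hstat : ∀ s : ℝ, μ.map (fun ω => shift s (X ω)) = μ.map X) {t : ℝ} (ht : 0 < t)
    (hg : Measurable g) (hf : Measurable f) {b c : ℝ≥0∞} (hb : b ≠ ∞) (hc : c ≠ ∞)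
    (hgb : ∀ x, g x ≤ b) (hfc : ∀ p, f p ≤ c) :
    ENNReal.ofReal t * ∫⁻ ω, cellWeight g f 0 0 (X ω) ∂μ =
      (∫⁻ x in Set.Ico (0 : ℝ) 1, g x) *
        ∫⁻ ω, ∑ k ∈ Finset.Icc (1 : ℤ) (nIdx (X ω).2 t), f (pointShift k (X ω)) ∂μ := by
  have hGtop : ∫⁻ x in Set.Ico (0 : ℝ) 1, g x ≠ ∞ := by
    refine ((lintegral_mono hgb).trans_lt ?_).ne
    simpa using hb.lt_top
  have hR : Measurable (residualWeight g f) := measurable_residualWeight hg hf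
  have hRX : Measurable fun ω => residualWeight g f (X ω) := hR.comp hX
  have hRtop : ∫⁻ ω, residualWeight g f (X ω) ∂μ ≠ ∞ := by
    refine ((lintegral_mono fun ω =>
      (residualWeight_le hg (hseq ω)).trans (mul_le_mul_right (hfc _) _)).trans_lt ?_).ne
    simpa using (ENNReal.mul_ne_top hGtop hc).lt_top
  have hF := measurable_uncurry_cellWeight_shift hX hpath hseq hg hf
  have hmean := lintegral_congr (μ := μ) fun ω =>
    lintegral_shift_add_residualWeight (f := f) hg (hpath ω) (hseq ω) ht.le
  rw [lintegral_add_left hF.lintegral_prod_right, lintegral_add_right _ hRX,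
    lintegral_comp_shift hX hstat hR, lintegral_lintegral_swap hF.aemeasurable,
    lintegral_const_mul' _ _ hGtop, ENNReal.add_left_inj hRtop] at hmean
  rw [← hmean]
  simp only [lintegral_comp_shift hX hstat (measurable_cellWeight_right hg hf 0 0)]
  simp [mul_comm]

theorem lintegral_cellWeight_of_stationary (hX : Measurable X)
    (hpath : ∀ ω, (X ω).1 ∈ pathSpace) (hseq : ∀ ω, (X ω).2 ∈ seqSpace)
    (hstat : ∀ s : ℝ, μ.map (fun ω => shift s (X ω)) = μ.map X) {t : ℝ} (ht : 0 < t)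
    (hg : Measurable g) (hf : Measurable f) :
    ENNReal.ofReal t * ∫⁻ ω, cellWeight g f 0 0 (X ω) ∂μ =
      (∫⁻ x in Set.Ico (0 : ℝ) 1, g x) *
        ∫⁻ ω, ∑ k ∈ Finset.Icc (1 : ℤ) (nIdx (X ω).2 t), f (pointShift k (X ω)) ∂μ := by
  let gn : ℕ → ℝ → ℝ≥0∞ := fun n x => min (g x) n
  let fn : ℕ → (ℝ → ℝ) × (ℤ → ℝ) → ℝ≥0∞ := fun n p => min (f p) n
  have hgn (n) : Measurable (gn n) := hg.min measurable_const
  have hfn (n) : Measurable (fn n) := hf.min measurable_const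
  have hgmono (x) : Monotone fun n => gn n x := fun m n h => min_le_min_left _ (by simpa using h)
  have hfmono (p) : Monotone fun n => fn n p := fun m n h => min_le_min_left _ (by simpa using h)
  have hgsup (x) : ⨆ n, gn n x = g x := iSup_min_natCast _
  have hfsup (p) : ⨆ n, fn n p = f p := iSup_min_natCast _
  have hleft : ∫⁻ ω, cellWeight g f 0 0 (X ω) ∂μ =
      ⨆ n, ∫⁻ ω, cellWeight (gn n) (fn n) 0 0 (X ω) ∂μ := by
    rw [← lintegral_iSup]
    · refine lintegral_congr fun ω => ?_
      simp only [cellWeight]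
      rw [← ENNReal.iSup_div, ← iSup_mul_iSup_of_monotone (hgmono _) (hfmono _), hgsup,
        hfsup]
    · exact fun n => (measurable_cellWeight_right (hgn n) (hfn n) 0 0).comp hX
    · intro m n h ω
      exact ENNReal.div_le_div_right (mul_le_mul' (hgmono _ h) (hfmono _ h)) _
  have hG : ∫⁻ x in Set.Ico (0 : ℝ) 1, g x = ⨆ n, ∫⁻ x in Set.Ico (0 : ℝ) 1, gn n x := by
    rw [← lintegral_iSup hgn fun m n h x => hgmono x h]
    simp only [hgsup]
  have hsum : ∫⁻ ω, ∑ k ∈ Finset.Icc (1 : ℤ) (nIdx (X ω).2 t), f (pointShift k (X ω)) ∂μ =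
      ⨆ n, ∫⁻ ω, ∑ k ∈ Finset.Icc (1 : ℤ) (nIdx (X ω).2 t), fn n (pointShift k (X ω)) ∂μ := by
    rw [← lintegral_iSup (fun n => measurable_sum_pointShift hX hseq (hfn n) t)
      fun m n h ω => Finset.sum_le_sum fun k _ => hfmono _ h]
    refine lintegral_congr fun ω => ?_
    rw [← ENNReal.finsetSum_iSup_of_monotone fun k => hfmono _]
    simp only [hfsup]
  rw [hleft, hG, hsum, ENNReal.mul_iSup, iSup_mul_iSup_of_monotone]
  · exact iSup_congr fun n => lintegral_cellWeight_of_bounded hX hpath hseq hstat ht (hgn n) (hfn n)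
      (ENNReal.natCast_ne_top n) (ENNReal.natCast_ne_top n) (fun _ => min_le_right _ _)
      (fun _ => min_le_right _ _)
  · exact fun m n h => lintegral_mono fun x => hgmono x h
  · exact fun m n h => lintegral_mono fun ω => Finset.sum_le_sum fun k _ => hfmono _ h

/-- Expectations of functions of the relative position and of the configuration seen from the
next point factorize. -/
theorem lintegral_mul_pointShift_of_stationary (hX : Measurable X)
    (hpath : ∀ ω, (X ω).1 ∈ pathSpace) (hseq : ∀ ω, (X ω).2 ∈ seqSpace)
    (hstat : ∀ s : ℝ, μ.map (fun ω => shift s (X ω)) = μ.map X)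
    (hg : Measurable g) (hf : Measurable f) :
    ∫⁻ ω, g (-(X ω).2 (-1) / ((X ω).2 0 - (X ω).2 (-1))) * f (pointShift 0 (X ω)) ∂μ =
      (∫⁻ x in Set.Ico (0 : ℝ) 1, g x) * ∫⁻ ω, f (pointShift 0 (X ω)) ∂μ := by
  let f' : (ℝ → ℝ) × (ℤ → ℝ) → ℝ≥0∞ := fun p => f p * ENNReal.ofReal (-p.2 (-2))
  have hf' : Measurable f' :=
    hf.mul ((measurable_pi_apply _).comp measurable_snd).neg.ennreal_ofReal
  have hcancel (h : ℝ → ℝ≥0∞) (ω : Ω) : cellWeight h f' 0 0 (X ω) =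
      h (-(X ω).2 (-1) / ((X ω).2 0 - (X ω).2 (-1))) * f (pointShift 0 (X ω)) := by
    have hpos : 0 < (X ω).2 0 - (X ω).2 (-1) := sub_pos.2 ((hseq ω).1 (by lia))
    have hlast : -(pointShift 0 (X ω)).2 (-2) = (X ω).2 0 - (X ω).2 (-1) := by simp [pointShift]
    simp only [cellWeight, f', hlast, zero_sub, ← mul_assoc]
    exact ENNReal.mul_div_cancel_right (by simpa using hpos) ENNReal.ofReal_ne_top
  have key := lintegral_cellWeight_of_stationary hX hpath hseq hstat one_pos hg hf'
  have key1 := lintegral_cellWeight_of_stationary hX hpath hseq hstat one_pos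
    (measurable_const (a := (1 : ℝ≥0∞))) hf'
  simp only [hcancel, ENNReal.ofReal_one, one_mul, lintegral_const, Measure.restrict_apply,
    MeasurableSet.univ, Set.univ_inter, Real.volume_Ico, sub_zero] at key key1
  rw [key, key1]

end stationary

/-- For a stationary random element `(K, P)` of `H × L`, the relative position
`U₀ = −P₋₁ / (P₀ − P₋₁)` is uniform on `[0, 1)` and independent of
`(K°, P°) = θ_{P₀}(K, P)`; moreover
`t · E[g(U₀) f(K°, P°)/l₀] = (∫₀¹ g) · E[Σ_{k=1}^{N_t} f(θ_{P_k}(K, P))]`. -/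
theorem relative_position_uniform_and_independent
    {Ω : Type*} [MeasurableSpace Ω] (μ : Measure Ω) [IsProbabilityMeasure μ]
    (K : Ω → ℝ → ℝ) (P : Ω → ℤ → ℝ)
    (hmem : ∀ ω, K ω ∈ pathSpace ∧ P ω ∈ seqSpace)
    (hmeas : Measurable fun ω => (K ω, P ω))
    (hstat : ∀ s : ℝ,
      Measure.map (fun ω => shift s (K ω, P ω)) μ = Measure.map (fun ω => (K ω, P ω)) μ) :
    Measure.map (fun ω => -(P ω (-1)) / (P ω 0 - P ω (-1))) μ
        = volume.restrict (Set.Ico (0:ℝ) 1) ∧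
    IndepFun (fun ω => -(P ω (-1)) / (P ω 0 - P ω (-1)))
      (fun ω => shift (P ω 0) (K ω, P ω)) μ ∧
    ∀ t : ℝ, 0 < t → ∀ g : ℝ → ℝ≥0∞, Measurable g →
      ∀ f : (ℝ → ℝ) × (ℤ → ℝ) → ℝ≥0∞, Measurable f →
        ENNReal.ofReal t *
            ∫⁻ ω, g (-(P ω (-1)) / (P ω 0 - P ω (-1))) *
              f (shift (P ω 0) (K ω, P ω)) / ENNReal.ofReal (P ω 0 - P ω (-1)) ∂μ
          = (∫⁻ x in Set.Ico (0:ℝ) 1, g x) *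
              ∫⁻ ω, ∑ k ∈ Finset.Icc (1:ℤ) (nIdx (P ω) t),
                f (shift (P ω k) (K ω, P ω)) ∂μ := by
  have hpath (ω : Ω) : (K ω, P ω).1 ∈ pathSpace := (hmem ω).1
  have hseq (ω : Ω) : (K ω, P ω).2 ∈ seqSpace := (hmem ω).2
  have hshift (ω : Ω) (k : ℤ) : shift (P ω k) (K ω, P ω) = pointShift k (K ω, P ω) :=
    (pointShift_eq_shift (hpath ω) (hseq ω) k).symm
  have hP (k : ℤ) : Measurable fun ω => P ω k :=
    (measurable_pi_apply k).comp (measurable_snd.comp hmeas)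
  have hU : Measurable fun ω => -(P ω (-1)) / (P ω 0 - P ω (-1)) :=
    (hP _).neg.div ((hP _).sub (hP _))
  have hpalm : Measurable fun ω => pointShift 0 (K ω, P ω) := (measurable_pointShift 0).comp hmeas
  simp only [hshift]
  have hunif : Measure.map (fun ω => -(P ω (-1)) / (P ω 0 - P ω (-1))) μ
      = volume.restrict (Set.Ico (0:ℝ) 1) := by
    ext s hs
    have := lintegral_mul_pointShift_of_stationary hmeas hpath hseq hstat
      (measurable_one.indicator hs) (measurable_const (a := (1 : ℝ≥0∞)))
    simp only [mul_one, lintegral_const, measure_univ] at this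
    rw [lintegral_indicator_one hs] at this
    rw [← this, ← lintegral_indicator_one hs, lintegral_map (measurable_one.indicator hs) hU]
  refine ⟨hunif, ?_, fun t ht g hg f hf => ?_⟩
  · rw [indepFun_iff_measure_inter_preimage_eq_mul]
    intro s A hs hA
    have key := lintegral_mul_pointShift_of_stationary hmeas hpath hseq hstat
      (measurable_one.indicator hs) (measurable_one.indicator hA)
    rw [lintegral_indicator_one hs, ← hunif, Measure.map_apply hU hs] at key
    rw [← lintegral_indicator_one (hpalm hA),
      ← lintegral_indicator_one ((hU hs).inter (hpalm hA))]
    refine Eq.trans (lintegral_congr fun ω => ?_) key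
    rw [Set.inter_indicator_one]
    rfl
  · simpa only [cellWeight, zero_sub] using
      lintegral_cellWeight_of_stationary hmeas hpath hseq hstat ht hg hf
end

section
/- Let (Ω, F, ℙ) be a probability space, let U : Ω → ℝ be uniformly distributed on [0, 1], and let Z : Ω → [0, ∞) and Y : Ω → [0, ∞) be measurable with Y bounded, such that U is independent of the pair (Y, Z). Then for every t > 0, E[Y · 1{t < U·Z}] = t · ∫_t^∞ E[Y · 1{r < Z}] · r^{−2} dr. -/
open MeasureTheory ProbabilityTheory

lemma setIntegral_Icc_indicator_lt_mul {t : ℝ} (ht : 0 < t) {z : ℝ} (hz : 0 ≤ z) :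
    ∫ u in Set.Icc (0:ℝ) 1, (if t < u * z then (1:ℝ) else 0)
      = if t < z then 1 - t / z else 0 := by
  split_ifs with h
  · have hz0 : 0 < z := ht.trans h
    have h1 : (fun u : ℝ => if t < u * z then (1:ℝ) else 0)
        = (Set.Ioi (t / z)).indicator (fun _ => (1:ℝ)) := by
      ext u
      simp only [Set.indicator, Set.mem_Ioi, div_lt_iff₀ hz0]
    have h2 : Set.Icc (0:ℝ) 1 ∩ Set.Ioi (t / z) = Set.Ioc (t / z) 1 := by
      ext u
      have : 0 < t / z := div_pos ht hz0
      simp only [Set.mem_inter_iff, Set.mem_Icc, Set.mem_Ioi, Set.mem_Ioc]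
      constructor
      · rintro ⟨⟨_, b⟩, c⟩
        exact ⟨c, b⟩
      · rintro ⟨c, b⟩
        exact ⟨⟨(this.trans c).le, b⟩, c⟩
    rw [h1, setIntegral_indicator measurableSet_Ioi, h2, setIntegral_const, smul_eq_mul, mul_one,
      Real.volume_real_Ioc_of_le ((div_le_one hz0).2 h.le)]
  · rw [setIntegral_congr_fun (g := fun _ => (0:ℝ)) measurableSet_Icc, integral_zero]
    intro u hu
    have : u * z ≤ z := mul_le_of_le_one_left hz hu.2
    exact if_neg (by linarith)

lemma mul_setIntegral_Ioi_indicator_lt_div_sq {t : ℝ} (ht : 0 < t) (z : ℝ) :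
    t * ∫ r in Set.Ioi t, (if r < z then (1:ℝ) else 0) / r ^ 2
      = if t < z then 1 - t / z else 0 := by
  split_ifs with h
  · have hz0 : 0 < z := ht.trans h
    have h1 : (fun r : ℝ => (if r < z then (1:ℝ) else 0) / r ^ 2)
        = (Set.Iio z).indicator (fun r => r ^ (-2 : ℤ)) := by
      ext r
      by_cases hr : r < z <;> simp [Set.indicator, hr, zpow_neg]
    have h0 : (0:ℝ) ∉ Set.uIcc t z := by
      rw [Set.uIcc_of_le h.le]
      exact fun h => absurd h.1 (not_le.2 ht)
    rw [h1, setIntegral_indicator measurableSet_Iio, Set.Ioi_inter_Iio,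
      ← integral_Ioc_eq_integral_Ioo, ← intervalIntegral.integral_of_le h.le,
      integral_zpow (Or.inr ⟨by norm_num, h0⟩)]
    norm_num [zpow_neg]
    field_simp
    ring
  · rw [setIntegral_congr_fun (g := fun _ => (0:ℝ)) measurableSet_Ioi, integral_zero, mul_zero]
    intro r hr
    have hr' : t < r := hr
    simp [show ¬ r < z by linarith]

/-- If `U` is uniform on `[0,1]`, independent of the pair `(Y, Z)` with `Y` bounded
nonnegative and `Z` nonnegative, then for every `t > 0`,
`E[Y · 1{t < U·Z}] = t · ∫_t^∞ E[Y · 1{r < Z}] r⁻² dr`. -/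
theorem uniform_size_bias_identity
    {Ω : Type*} [MeasurableSpace Ω] (μ : Measure Ω) [IsProbabilityMeasure μ]
    (U Y Z : Ω → ℝ)
    (hUmeas : Measurable U) (hYmeas : Measurable Y) (hZmeas : Measurable Z)
    (hU : Measure.map U μ = volume.restrict (Set.Icc (0:ℝ) 1))
    (hYnn : ∀ ω, 0 ≤ Y ω) (hZnn : ∀ ω, 0 ≤ Z ω)
    (hYbdd : ∃ C : ℝ, ∀ ω, Y ω ≤ C)
    (hindep : IndepFun U (fun ω => (Y ω, Z ω)) μ)
    (t : ℝ) (ht : 0 < t) :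
    ∫ ω, Y ω * (if t < U ω * Z ω then (1:ℝ) else 0) ∂μ
      = t * ∫ r in Set.Ioi t, (∫ ω, Y ω * (if r < Z ω then (1:ℝ) else 0) ∂μ) / r ^ 2 := by
  obtain ⟨C, hC⟩ := hYbdd
  have hYC : ∀ ω, ‖Y ω‖ ≤ C := fun ω => by
    rw [Real.norm_of_nonneg (hYnn ω)]
    exact hC ω
  have hYZ : Measurable fun ω => (Y ω, Z ω) := hYmeas.prodMk hZmeas
  have hYint : Integrable Y μ := .of_bound hYmeas.aestronglyMeasurable C (.of_forall hYC)
  have hlaw : μ.map (fun ω => (U ω, (Y ω, Z ω)))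
      = (volume.restrict (Set.Icc (0:ℝ) 1)).prod (μ.map fun ω => (Y ω, Z ω)) := by
    rw [(indepFun_iff_map_prod_eq_prod_map_map hUmeas.aemeasurable hYZ.aemeasurable).1 hindep, hU]
  have hfmeas : Measurable fun p : ℝ × ℝ × ℝ =>
      p.2.1 * (if t < p.1 * p.2.2 then (1:ℝ) else 0) :=
    measurable_snd.fst.mul (Measurable.ite
      (measurableSet_lt measurable_const (measurable_fst.mul measurable_snd.snd))
      measurable_const measurable_const)
  have hfint : Integrable (fun p : ℝ × ℝ × ℝ => p.2.1 * (if t < p.1 * p.2.2 then (1:ℝ) else 0))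
      ((volume.restrict (Set.Icc (0:ℝ) 1)).prod (μ.map fun ω => (Y ω, Z ω))) := by
    rw [← hlaw, integrable_map_measure hfmeas.aestronglyMeasurable
      (hUmeas.prodMk hYZ).aemeasurable]
    refine hYint.mono (hfmeas.comp (hUmeas.prodMk hYZ)).aestronglyMeasurable (.of_forall fun ω => ?_)
    simp only [Function.comp]
    split_ifs <;> simp
  have hleft : ∫ ω, Y ω * (if t < U ω * Z ω then (1:ℝ) else 0) ∂μ
      = ∫ ω, Y ω * (if t < Z ω then 1 - t / Z ω else 0) ∂μ := by
    rw [← integral_map (φ := fun ω => (U ω, (Y ω, Z ω)))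
        (f := fun p : ℝ × ℝ × ℝ => p.2.1 * (if t < p.1 * p.2.2 then (1:ℝ) else 0))
        (hUmeas.prodMk hYZ).aemeasurable hfmeas.aestronglyMeasurable, hlaw,
      integral_prod_symm _ hfint,
      integral_map hYZ.aemeasurable hfint.integral_prod_right.aestronglyMeasurable]
    refine integral_congr_ae (.of_forall fun ω => ?_)
    simp only [integral_const_mul, setIntegral_Icc_indicator_lt_mul ht (hZnn ω)]
  have hrint : IntegrableOn (fun r : ℝ => (r ^ 2)⁻¹) (Set.Ioi t) := by
    refine (integrableOn_Ioi_rpow_of_lt (by norm_num : (-2:ℝ) < -1) ht).congr_fun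
      (fun r hr => ?_) measurableSet_Ioi
    have hr0 : 0 < r := ht.trans hr
    simp only [Real.rpow_neg hr0.le, Real.rpow_ofNat]
  have hgint : Integrable (Function.uncurry fun (r : ℝ) (ω : Ω) =>
      Y ω * ((if r < Z ω then (1:ℝ) else 0) / r ^ 2)) ((volume.restrict (Set.Ioi t)).prod μ) := by
    refine (Integrable.mul_prod hrint hYint).mono (Measurable.aestronglyMeasurable ?_)
      (.of_forall fun p => ?_)
    · exact (hYmeas.comp measurable_snd).mul ((Measurable.ite
        (measurableSet_lt measurable_fst (hZmeas.comp measurable_snd))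
        measurable_const measurable_const).div (measurable_fst.pow_const 2))
    · simp only [Function.uncurry]
      split_ifs
      · simp [mul_comm]
      · simp only [zero_div, mul_zero, norm_zero]
        positivity
  rw [hleft]
  calc ∫ ω, Y ω * (if t < Z ω then 1 - t / Z ω else 0) ∂μ
      = ∫ ω, (t * ∫ r in Set.Ioi t, Y ω * ((if r < Z ω then (1:ℝ) else 0) / r ^ 2)) ∂μ := by
        refine integral_congr_ae (.of_forall fun ω => ?_)
        simp only [integral_const_mul]
        rw [← mul_setIntegral_Ioi_indicator_lt_div_sq ht, mul_left_comm]
    _ = t * ∫ r in Set.Ioi t, ∫ ω, Y ω * ((if r < Z ω then (1:ℝ) else 0) / r ^ 2) ∂μ := by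
        rw [integral_const_mul, integral_integral_swap hgint]
    _ = _ := by simp only [← mul_div_assoc, integral_div]
end

section
/- For all real numbers a, b > 0, ∫_0^∞ (e^{−a t} − e^{−b t}) / √(2π t³) dt = √(2b) − √(2a). -/
open Real

open MeasureTheory Set Filter Topology

lemma abs_exp_neg_mul_sub_le (a b : ℝ) {t : ℝ} (ht : 0 ≤ t) :
    |exp (-a * t) - exp (-b * t)| ≤ |b - a| * (t * exp (-min a b * t)) := by
  wlog hab : a ≤ b generalizing a b
  · rw [abs_sub_comm, abs_sub_comm b, min_comm]
    exact this b a (le_of_not_ge hab)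
  have h_le : exp (-b * t) ≤ exp (-a * t) := exp_le_exp.2 (by nlinarith)
  have h_prod : exp (-b * t) = exp (-a * t) * exp (-((b - a) * t)) := by
    rw [← exp_add]; ring_nf
  have h_one := one_sub_le_exp_neg ((b - a) * t)
  rw [min_eq_left hab, abs_of_nonneg (sub_nonneg.2 h_le), abs_of_nonneg (sub_nonneg.2 hab), h_prod]
  nlinarith [exp_pos (-a * t)]

lemma integrableOn_rpow_neg_half_mul_exp_neg_mul {a : ℝ} (ha : 0 < a) :
    IntegrableOn (fun t : ℝ => t ^ (-1 / 2 : ℝ) * exp (-a * t)) (Ioi 0) := by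
  simpa using integrableOn_rpow_mul_exp_neg_mul_rpow (s := -1 / 2) (by norm_num) one_pos ha

lemma integral_rpow_neg_half_mul_exp_neg_mul {a : ℝ} (ha : 0 < a) :
    ∫ t in Ioi (0 : ℝ), t ^ (-1 / 2 : ℝ) * exp (-a * t) = √π / √a := by
  have h := integral_rpow_mul_exp_neg_mul_Ioi (a := 1 / 2) (by norm_num) ha
  rw [Gamma_one_half_eq, ← sqrt_eq_rpow, sqrt_div zero_le_one, sqrt_one] at h
  norm_num at h ⊢
  rw [h]
  ring

lemma integrableOn_exp_neg_mul_sub_mul_rpow {a b : ℝ} (ha : 0 < a) (hb : 0 < b) :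
    IntegrableOn (fun t : ℝ => (exp (-a * t) - exp (-b * t)) * t ^ (-3 / 2 : ℝ)) (Ioi 0) := by
  refine ((integrableOn_rpow_neg_half_mul_exp_neg_mul (lt_min ha hb)).const_mul |b - a|).mono'
    (by fun_prop) ?_
  filter_upwards [ae_restrict_mem measurableSet_Ioi] with t (ht : 0 < t)
  rw [norm_mul, norm_eq_abs, norm_of_nonneg (rpow_nonneg ht.le _)]
  refine (mul_le_mul_of_nonneg_right (abs_exp_neg_mul_sub_le a b ht.le)
    (rpow_nonneg ht.le _)).trans_eq ?_
  have h : t ^ (-1 / 2 : ℝ) = t * t ^ (-3 / 2 : ℝ) := by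
    rw [← rpow_one_add' ht.le (by norm_num)]; norm_num
  rw [h]; ring

lemma tendsto_exp_neg_mul_sub_mul_rpow_nhdsGT (a b : ℝ) :
    Tendsto (fun t : ℝ => (exp (-a * t) - exp (-b * t)) * (-2 * t ^ (-1 / 2 : ℝ)))
      (𝓝[>] 0) (𝓝 0) := by
  have h_lim : Tendsto (fun t : ℝ => 2 * |b - a| * (t ^ (1 / 2 : ℝ) * exp (-min a b * t)))
      (𝓝[>] 0) (𝓝 0) := by
    have h : ContinuousAt (fun t : ℝ => 2 * |b - a| * (t ^ (1 / 2 : ℝ) * exp (-min a b * t))) 0 :=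
      ((continuousAt_rpow_const _ _ (Or.inr (by norm_num))).mul (by fun_prop)).const_mul _
    have h_tendsto := h.tendsto
    rw [zero_rpow (by norm_num), zero_mul, mul_zero] at h_tendsto
    exact h_tendsto.mono_left nhdsWithin_le_nhds
  refine squeeze_zero_norm' ?_ h_lim
  filter_upwards [self_mem_nhdsWithin] with t (ht : 0 < t)
  have hr := rpow_nonneg ht.le (-1 / 2 : ℝ)
  rw [norm_mul, norm_eq_abs, norm_mul, norm_of_nonneg hr]
  have h : t ^ (1 / 2 : ℝ) = t * t ^ (-1 / 2 : ℝ) := by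
    rw [← rpow_one_add' ht.le (by norm_num)]; norm_num
  refine (mul_le_mul_of_nonneg_right (abs_exp_neg_mul_sub_le a b ht.le)
    (by positivity)).trans_eq ?_
  rw [h]; norm_num; ring

lemma tendsto_exp_neg_mul_sub_mul_rpow_atTop {a b : ℝ} (ha : 0 < a) (hb : 0 < b) :
    Tendsto (fun t : ℝ => (exp (-a * t) - exp (-b * t)) * (-2 * t ^ (-1 / 2 : ℝ)))
      atTop (𝓝 0) := by
  have h := ((tendsto_rpow_mul_exp_neg_mul_atTop_nhds_zero (-1 / 2) a ha).sub
    (tendsto_rpow_mul_exp_neg_mul_atTop_nhds_zero (-1 / 2) b hb)).const_mul (-2)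
  rw [sub_zero, mul_zero] at h
  exact h.congr fun t => by ring

lemma integral_exp_neg_mul_sub_mul_rpow {a b : ℝ} (ha : 0 < a) (hb : 0 < b) :
    ∫ t in Ioi (0 : ℝ), (exp (-a * t) - exp (-b * t)) * t ^ (-3 / 2 : ℝ)
      = 2 * √π * (√b - √a) := by
  have hu : ∀ t ∈ Ioi (0 : ℝ), HasDerivAt (fun t => exp (-a * t) - exp (-b * t))
      (exp (-a * t) * -a - exp (-b * t) * -b) t := fun t _ =>
    (hasDerivAt_const_mul (-a)).exp.sub (hasDerivAt_const_mul (-b)).exp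
  have hv : ∀ t ∈ Ioi (0 : ℝ), HasDerivAt (fun t : ℝ => -2 * t ^ (-1 / 2 : ℝ))
      (t ^ (-3 / 2 : ℝ)) t := by
    intro t (ht : 0 < t)
    convert! (hasDerivAt_rpow_const (p := -1 / 2) (Or.inl ht.ne')).const_mul (-2) using 1
    norm_num
    ring
  have h_eq : (fun t : ℝ => (exp (-a * t) * -a - exp (-b * t) * -b) * (-2 * t ^ (-1 / 2 : ℝ)))
      = fun t => 2 * a * (t ^ (-1 / 2 : ℝ) * exp (-a * t))
        - 2 * b * (t ^ (-1 / 2 : ℝ) * exp (-b * t)) := by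
    ext t; ring
  have hia := (integrableOn_rpow_neg_half_mul_exp_neg_mul ha).const_mul (2 * a)
  have hib := (integrableOn_rpow_neg_half_mul_exp_neg_mul hb).const_mul (2 * b)
  rw [integral_Ioi_mul_deriv_eq_deriv_mul hu hv (integrableOn_exp_neg_mul_sub_mul_rpow ha hb)
    (by rw [Pi.mul_def, h_eq]; exact hia.sub hib)
    (tendsto_exp_neg_mul_sub_mul_rpow_nhdsGT a b) (tendsto_exp_neg_mul_sub_mul_rpow_atTop ha hb),
    h_eq, integral_sub hia hib, integral_const_mul, integral_const_mul,
    integral_rpow_neg_half_mul_exp_neg_mul ha, integral_rpow_neg_half_mul_exp_neg_mul hb]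
  have h_div : ∀ x : ℝ, 2 * x * (√π / √x) = 2 * √π * √x := fun x => calc
    2 * x * (√π / √x) = 2 * √π * (x / √x) := by ring
    _ = 2 * √π * √x := by rw [div_sqrt]
  rw [h_div, h_div]
  ring

/-- For `a, b > 0`, `∫₀^∞ (e^{−a t} − e^{−b t})/√(2π t³) dt = √(2b) − √(2a)`. -/
theorem integral_exp_diff_div_sqrt_cube (a b : ℝ) (ha : 0 < a) (hb : 0 < b) :
    ∫ t in Set.Ioi (0:ℝ), (Real.exp (-a * t) - Real.exp (-b * t)) / Real.sqrt (2 * π * t ^ 3)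
      = Real.sqrt (2 * b) - Real.sqrt (2 * a) := by
  have h_eq : ∀ t ∈ Ioi (0 : ℝ), (exp (-a * t) - exp (-b * t)) / √(2 * π * t ^ 3)
      = (√(2 * π))⁻¹ * ((exp (-a * t) - exp (-b * t)) * t ^ (-3 / 2 : ℝ)) := by
    intro t (ht : 0 < t)
    have h : t ^ (-3 / 2 : ℝ) = (√(t ^ 3))⁻¹ := by
      rw [sqrt_eq_rpow, ← rpow_natCast, ← rpow_mul ht.le, ← rpow_neg ht.le]; norm_num
    rw [sqrt_mul (by positivity), h, div_eq_mul_inv, mul_inv]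
    ring
  rw [setIntegral_congr_fun measurableSet_Ioi h_eq, integral_const_mul,
    integral_exp_neg_mul_sub_mul_rpow ha hb, sqrt_mul zero_le_two, sqrt_mul zero_le_two,
    sqrt_mul zero_le_two]
  field_simp
  rw [sq_sqrt zero_le_two]
end

section
/- Let α > 0, β ∈ ℝ with |β| < α, and λ ≥ 0. Then ∫_0^∞ ∫_0^{2αt} e^{−λ t} · e^{−x(√(2λ + (α+β)²) − (α+β))} · exp(−(α−β)² t / 2 − 2(α+β) x) / √(2π t³) dx dt = 4α / (2α + √(2λ + (α+β)²) + √(2λ + (α−β)²)). In particular (taking λ = 0), the function f(t, x) = exp(−(α−β)² t/2 − 2(α+β)x) / √(2π t³) · 1{0 ≤ x ≤ 2αt, t > 0} is a probability density on ℝ², and the left-hand side is the Laplace transform at λ of the law of the excursion length ζ = τ + T̃_γ̂ associated with this density. -/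
open Real

open MeasureTheory Filter Topology in
/-- The Frullani-type integral `∫₀^∞ (e^{-pt} - e^{-qt}) t^{-3/2} dt = 2 √π (√q - √p)`. -/
theorem integral_exp_sub_exp_mul_rpow_neg_three_halves {p q : ℝ} (hp : 0 < p) (hpq : p < q) :
    ∫ t in Set.Ioi (0:ℝ), (exp (-(p * t)) - exp (-(q * t))) * t ^ (-(3 / 2) : ℝ)
      = 2 * √π * (√q - √p) := by
  have hq : 0 < q := hp.trans hpq
  have gamma_int : ∀ r : ℝ, 0 < r →
      IntegrableOn (fun t : ℝ ↦ t ^ (-(1 / 2) : ℝ) * exp (-(r * t))) (Set.Ioi 0) := by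
    intro r hr
    have := integrableOn_rpow_mul_exp_neg_mul_rpow (s := -(1 / 2)) (p := 1) (b := r)
      (by norm_num) one_pos hr
    simpa using this
  have gamma_val : ∀ r : ℝ, 0 < r →
      r * ∫ t in Set.Ioi (0:ℝ), t ^ (-(1 / 2) : ℝ) * exp (-(r * t)) = √π * √r := by
    intro r hr
    have h := Real.integral_rpow_mul_exp_neg_mul_Ioi (a := 1 / 2) (by norm_num) hr
    rw [show (1 / 2 - 1 : ℝ) = -(1 / 2) by norm_num, Real.Gamma_one_half_eq,
      ← Real.sqrt_eq_rpow, Real.sqrt_div zero_le_one, Real.sqrt_one] at h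
    rw [h]
    have : √r ≠ 0 := (Real.sqrt_pos.2 hr).ne'
    field_simp
    rw [Real.sq_sqrt hr.le]
  have diff_nonneg : ∀ t : ℝ, 0 ≤ t → 0 ≤ exp (-(p * t)) - exp (-(q * t)) := by
    intro t ht
    rw [sub_nonneg, exp_le_exp]
    nlinarith
  have diff_le : ∀ t : ℝ, exp (-(p * t)) - exp (-(q * t)) ≤ (q - p) * t * exp (-(p * t)) := by
    intro t
    have h1 := add_one_le_exp (-((q - p) * t))
    have h2 : exp (-(q * t)) = exp (-((q - p) * t)) * exp (-(p * t)) := by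
      rw [← exp_add]; ring_nf
    rw [h2]
    nlinarith [exp_pos (-(p * t))]
  have rpow_step : ∀ t : ℝ, 0 < t → t * t ^ (-(3 / 2) : ℝ) = t ^ (-(1 / 2) : ℝ) := by
    intro t ht
    rw [← rpow_one_add' ht.le (by norm_num)]
    norm_num
  have rpow_step' : ∀ t : ℝ, 0 < t → t * t ^ (-(1 / 2) : ℝ) = t ^ (1 / 2 : ℝ) := by
    intro t ht
    rw [← rpow_one_add' ht.le (by norm_num)]
    norm_num
  have main_int : IntegrableOn
      (fun t : ℝ ↦ (exp (-(p * t)) - exp (-(q * t))) * t ^ (-(3 / 2) : ℝ)) (Set.Ioi 0) := by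
    refine Integrable.mono' ((gamma_int p hp).const_mul (q - p)) ?_ ?_
    · exact Measurable.aestronglyMeasurable (by fun_prop)
    · filter_upwards [ae_restrict_mem measurableSet_Ioi] with t ht
      have ht : 0 < t := ht
      have h3 : 0 ≤ t ^ (-(3 / 2) : ℝ) := rpow_nonneg ht.le _
      rw [Real.norm_of_nonneg (mul_nonneg (diff_nonneg t ht.le) h3), ← rpow_step t ht]
      calc _ ≤ (q - p) * t * exp (-(p * t)) * t ^ (-(3 / 2) : ℝ) :=
            mul_le_mul_of_nonneg_right (diff_le t) h3
        _ = _ := by ring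
  have bdry_bound : ∀ t : ℝ, 0 < t →
      (exp (-(p * t)) - exp (-(q * t))) * t ^ (-(1 / 2) : ℝ)
        ≤ (q - p) * (t ^ (1 / 2 : ℝ) * exp (-p * t)) := by
    intro t ht
    rw [← rpow_step' t ht, neg_mul]
    calc _ ≤ (q - p) * t * exp (-(p * t)) * t ^ (-(1 / 2) : ℝ) :=
          mul_le_mul_of_nonneg_right (diff_le t) (rpow_nonneg ht.le _)
      _ = _ := by ring
  have bdry_lim : ∀ l : Filter ℝ, (∀ᶠ t in l, 0 < t) →
      Tendsto (fun t : ℝ ↦ t ^ (1 / 2 : ℝ) * exp (-p * t)) l (𝓝 0) →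
      Tendsto (fun t : ℝ ↦ (exp (-(p * t)) - exp (-(q * t))) * t ^ (-(1 / 2) : ℝ)) l (𝓝 0) := by
    intro l hl hlim
    have hlim' := hlim.const_mul (q - p)
    rw [mul_zero] at hlim'
    refine tendsto_of_tendsto_of_tendsto_of_le_of_le' tendsto_const_nhds hlim' ?_ ?_
    · filter_upwards [hl] with t ht
      exact mul_nonneg (diff_nonneg t ht.le) (rpow_nonneg ht.le _)
    · filter_upwards [hl] with t ht using bdry_bound t ht
  have lim_top := bdry_lim atTop (eventually_gt_atTop 0)
    (tendsto_rpow_mul_exp_neg_mul_atTop_nhds_zero (1 / 2) p hp)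
  have lim_zero := bdry_lim (𝓝[>] 0) self_mem_nhdsWithin (by
    have : Continuous (fun t : ℝ ↦ t ^ (1 / 2 : ℝ) * exp (-p * t)) :=
      (continuous_id.rpow_const fun _ ↦ Or.inr (by norm_num)).mul (by fun_prop)
    have h := (this.tendsto 0).mono_left (nhdsWithin_le_nhds (s := Set.Ioi 0))
    rwa [zero_rpow (by norm_num), zero_mul] at h)
  have hu : ∀ t ∈ Set.Ioi (0:ℝ), HasDerivAt (fun t : ℝ ↦ exp (-(p * t)) - exp (-(q * t)))
      (q * exp (-(q * t)) - p * exp (-(p * t))) t := by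
    intro t _
    have h : ∀ r : ℝ, HasDerivAt (fun t : ℝ ↦ exp (-(r * t))) (exp (-(r * t)) * -(r * 1)) t :=
      fun r ↦ (((hasDerivAt_id t).const_mul r).neg).exp
    exact ((h p).sub (h q)).congr_deriv (by ring)
  have hv : ∀ t ∈ Set.Ioi (0:ℝ), HasDerivAt (fun t : ℝ ↦ -2 * t ^ (-(1 / 2) : ℝ))
      (t ^ (-(3 / 2) : ℝ)) t := by
    intro t ht
    have h := (Real.hasDerivAt_rpow_const (x := t) (p := -(1 / 2))
      (Or.inl (ne_of_gt ht))).const_mul (-2)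
    rw [show (-(1 / 2) - 1 : ℝ) = -(3 / 2) by norm_num] at h
    exact h.congr_deriv (by ring)
  have int_q := (gamma_int q hq).const_mul q
  have int_p := (gamma_int p hp).const_mul p
  have deriv_mul_eq : ∀ t : ℝ,
      (q * exp (-(q * t)) - p * exp (-(p * t))) * (-2 * t ^ (-(1 / 2) : ℝ))
        = -2 * (q * (t ^ (-(1 / 2) : ℝ) * exp (-(q * t)))
          - p * (t ^ (-(1 / 2) : ℝ) * exp (-(p * t)))) := fun t ↦ by ring
  have boundary : ∀ l : Filter ℝ,
      Tendsto (fun t : ℝ ↦ (exp (-(p * t)) - exp (-(q * t))) * t ^ (-(1 / 2) : ℝ)) l (𝓝 0) →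
      Tendsto ((fun t : ℝ ↦ exp (-(p * t)) - exp (-(q * t))) *
        fun t : ℝ ↦ -2 * t ^ (-(1 / 2) : ℝ)) l (𝓝 0) := by
    intro l h
    have h' := h.const_mul (-2)
    rw [mul_zero] at h'
    refine h'.congr fun t ↦ ?_
    simp only [Pi.mul_apply]
    ring
  rw [integral_Ioi_mul_deriv_eq_deriv_mul hu hv main_int
    (((int_q.sub int_p).const_mul (-2)).congr (.of_forall fun t ↦ (deriv_mul_eq t).symm))
    (boundary _ lim_zero) (boundary _ lim_top)]
  simp_rw [deriv_mul_eq]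
  rw [integral_const_mul, integral_sub int_q int_p, integral_const_mul, integral_const_mul,
    gamma_val q hq, gamma_val p hp]
  ring

/-- The integral of an exponential over the wedge `0 < x < a t` against `(2 π t³)^{-1/2}`. -/
theorem integral_wedge_exp_div_sqrt {p c a : ℝ} (hp : 0 < p) (hc : 0 < c) (ha : 0 < a) :
    ∫ t in Set.Ioi (0:ℝ), ∫ x in Set.Ioo (0:ℝ) (a * t), exp (-(p * t) - c * x) / √(2 * π * t ^ 3)
      = (√(2 * (p + c * a)) - √(2 * p)) / c := by
  have inner : ∀ t ∈ Set.Ioi (0:ℝ),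
      ∫ x in Set.Ioo (0:ℝ) (a * t), exp (-(p * t) - c * x) / √(2 * π * t ^ 3)
        = (c * √(2 * π))⁻¹ *
          ((exp (-(p * t)) - exp (-((p + c * a) * t))) * t ^ (-(3 / 2) : ℝ)) := by
    intro t ht
    have ht : 0 < t := ht
    rw [← MeasureTheory.integral_Ioc_eq_integral_Ioo,
      ← intervalIntegral.integral_of_le (mul_pos ha ht).le]
    have hd : ∀ x ∈ Set.uIcc 0 (a * t),
        HasDerivAt (fun x : ℝ ↦ -(exp (-(p * t) - c * x) / c / √(2 * π * t ^ 3)))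
          (exp (-(p * t) - c * x) / √(2 * π * t ^ 3)) x := by
      intro x _
      have h := (((((hasDerivAt_id x).const_mul c).const_sub (-(p * t))).exp.div_const c).div_const
        (√(2 * π * t ^ 3))).neg
      refine h.congr_deriv ?_
      simp only [id]
      field_simp
    rw [intervalIntegral.integral_eq_sub_of_hasDerivAt hd
      (Continuous.intervalIntegrable (by fun_prop) _ _)]
    have hs : √(2 * π * t ^ 3) = √(2 * π) * t ^ (3 / 2 : ℝ) := by
      rw [Real.sqrt_mul (by positivity), Real.sqrt_eq_rpow (t ^ 3), ← Real.rpow_natCast,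
        ← Real.rpow_mul ht.le]
      norm_num
    rw [hs, Real.rpow_neg ht.le,
      show -((p + c * a) * t) = -(p * t) - c * (a * t) by ring, mul_zero, sub_zero]
    field_simp
    ring
  rw [MeasureTheory.setIntegral_congr_fun measurableSet_Ioi inner,
    MeasureTheory.integral_const_mul,
    integral_exp_sub_exp_mul_rpow_neg_three_halves hp (lt_add_of_pos_right p (mul_pos hc ha)),
    Real.sqrt_mul zero_le_two, Real.sqrt_mul zero_le_two, Real.sqrt_mul zero_le_two]
  have h2 : √2 * √2 = 2 := Real.mul_self_sqrt zero_le_two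
  have hpi : √π ≠ 0 := (Real.sqrt_pos.2 Real.pi_pos).ne'
  field_simp
  linear_combination (√p - √(p + c * a)) * h2

/-- Laplace transform of the generic excursion length for Brownian motion with drift `β`,
`|β| < α`: the double integral against the joint density
`f(t,x) = exp(−(α−β)² t/2 − 2(α+β) x)/√(2π t³)` on `{0 < x < 2αt}` of
`e^{−λt} e^{−x(√(2λ+(α+β)²) − (α+β))}` equals
`4α/(2α + √(2λ+(α+β)²) + √(2λ+(α−β)²))`; in particular (taking `λ = 0`) the function
`f` is a probability density. -/
theorem excursion_length_laplace (α β lam : ℝ) (hα : 0 < α) (hβ : |β| < α)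
    (hlam : 0 ≤ lam) :
    (∫ t in Set.Ioi (0:ℝ), ∫ x in Set.Ioo (0:ℝ) (2 * α * t),
        Real.exp (-lam * t) *
          Real.exp (-x * (Real.sqrt (2 * lam + (α + β) ^ 2) - (α + β))) *
          (Real.exp (-(α - β) ^ 2 * t / 2 - 2 * (α + β) * x) / Real.sqrt (2 * π * t ^ 3))
      = 4 * α /
          (2 * α + Real.sqrt (2 * lam + (α + β) ^ 2) + Real.sqrt (2 * lam + (α - β) ^ 2))) ∧
    (∫ t in Set.Ioi (0:ℝ), ∫ x in Set.Ioo (0:ℝ) (2 * α * t),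
        Real.exp (-(α - β) ^ 2 * t / 2 - 2 * (α + β) * x) / Real.sqrt (2 * π * t ^ 3)
      = 1) := by
  have hs : 0 < α + β := by linarith [neg_abs_le β]
  have hd : 0 < α - β := by linarith [le_abs_self β]
  have laplace : ∀ l : ℝ, 0 ≤ l →
      ∫ t in Set.Ioi (0:ℝ), ∫ x in Set.Ioo (0:ℝ) (2 * α * t),
        Real.exp (-l * t) *
          Real.exp (-x * (Real.sqrt (2 * l + (α + β) ^ 2) - (α + β))) *
          (Real.exp (-(α - β) ^ 2 * t / 2 - 2 * (α + β) * x) / Real.sqrt (2 * π * t ^ 3))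
      = 4 * α /
          (2 * α + Real.sqrt (2 * l + (α + β) ^ 2) + Real.sqrt (2 * l + (α - β) ^ 2)) := by
    intro l hl
    set S := √(2 * l + (α + β) ^ 2) with hS
    set D := √(2 * l + (α - β) ^ 2) with hD
    have hS0 : 0 ≤ S := Real.sqrt_nonneg _
    have hD0 : 0 ≤ D := Real.sqrt_nonneg _
    have hS2 : S ^ 2 = 2 * l + (α + β) ^ 2 := Real.sq_sqrt (by positivity)
    have hD2 : D ^ 2 = 2 * l + (α - β) ^ 2 := Real.sq_sqrt (by positivity)
    have hc : 0 < S + (α + β) := by linarith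
    have integrand : ∀ t x : ℝ,
        exp (-l * t) * exp (-x * (S - (α + β))) *
            (exp (-(α - β) ^ 2 * t / 2 - 2 * (α + β) * x) / √(2 * π * t ^ 3))
          = exp (-((l + (α - β) ^ 2 / 2) * t) - (S + (α + β)) * x) / √(2 * π * t ^ 3) := by
      intro t x
      rw [← exp_add, ← mul_div_assoc, ← exp_add]
      ring_nf
    simp_rw [integrand]
    rw [integral_wedge_exp_div_sqrt (by positivity) hc (by positivity),
      show 2 * (l + (α - β) ^ 2 / 2 + (S + (α + β)) * (2 * α)) = (S + 2 * α) ^ 2 by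
        linear_combination -hS2,
      show 2 * (l + (α - β) ^ 2 / 2) = 2 * l + (α - β) ^ 2 by ring, ← hD,
      Real.sqrt_sq (by positivity), div_eq_div_iff hc.ne' (by positivity)]
    linear_combination hS2 - hD2
  refine ⟨laplace lam hlam, ?_⟩
  have h := laplace 0 le_rfl
  simp only [mul_zero, zero_add, Real.sqrt_sq hs.le, Real.sqrt_sq hd.le, sub_self, neg_zero,
    zero_mul, exp_zero, one_mul] at h
  rw [h, div_eq_one_iff_eq (by linarith)]
  ring
end

section
/- Let α > 0 and λ ≥ 0. Then ∫_0^∞ e^{−λ l} · (2α e^{−α² l/2} / √(2π l) − 2α² Φ̄(α √l)) dl = 2α / (α + √(2λ + α²)), where Φ̄(x) = ∫_x^∞ e^{−u²/2}/√(2π) du. Consequently, the function l ↦ 2α e^{−α² l/2}/√(2π l) − 2α² Φ̄(α√l) on (0, ∞) is the probability density whose Laplace transform is λ ↦ 4α/(2α + 2√(2λ + α²)). -/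
open Real

/-- The standard Gaussian upper tail `Φ̄(x) = ∫_x^∞ e^{−u²/2}/√(2π) du`. -/
noncomputable def gaussTail (x : ℝ) : ℝ :=
  ∫ u in Set.Ioi x, Real.exp (-u ^ 2 / 2) / Real.sqrt (2 * π)

open MeasureTheory Filter Topology

lemma continuous_gaussPDF :
    Continuous fun u : ℝ => Real.exp (-u ^ 2 / 2) / Real.sqrt (2 * π) := by
  fun_prop

lemma integrable_gaussPDF :
    Integrable fun u : ℝ => Real.exp (-u ^ 2 / 2) / Real.sqrt (2 * π) := by
  have h := (integrable_exp_neg_mul_sq (b := 1 / 2) (by norm_num)).div_const (Real.sqrt (2 * π))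
  refine h.congr (Eventually.of_forall fun u => ?_)
  have : -(1 / 2 : ℝ) * u ^ 2 = -u ^ 2 / 2 := by ring
  simp only [this]

lemma gaussTail_zero : gaussTail 0 = 1 / 2 := by
  have h := integral_gaussian_Ioi (1 / 2)
  have h2 : π / (1 / 2) = 2 * π := by ring
  have h3 : ∀ u : ℝ, -(1 / 2 : ℝ) * u ^ 2 = -u ^ 2 / 2 := fun u => by ring
  simp only [h2, h3] at h
  have hpos : 0 < Real.sqrt (2 * π) := by positivity
  rw [gaussTail, integral_div, h]
  field_simp

lemma gaussTail_eq_sub (x : ℝ) :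
    gaussTail x = gaussTail 0 - ∫ u in (0 : ℝ)..x, Real.exp (-u ^ 2 / 2) / Real.sqrt (2 * π) := by
  have h := intervalIntegral.integral_interval_add_Ioi (a := 0) (b := x)
    integrable_gaussPDF.integrableOn integrable_gaussPDF.integrableOn
  unfold gaussTail
  linarith

lemma hasDerivAt_gaussTail (x : ℝ) :
    HasDerivAt gaussTail (-(Real.exp (-x ^ 2 / 2) / Real.sqrt (2 * π))) x := by
  have h := (continuous_gaussPDF.integral_hasStrictDerivAt 0 x).hasDerivAt.const_sub (gaussTail 0)
  exact h.congr_of_eventuallyEq (Eventually.of_forall gaussTail_eq_sub)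

lemma continuous_gaussTail : Continuous gaussTail :=
  continuous_iff_continuousAt.2 fun x => (hasDerivAt_gaussTail x).continuousAt

lemma gaussTail_nonneg (x : ℝ) : 0 ≤ gaussTail x :=
  setIntegral_nonneg measurableSet_Ioi fun _ _ => by positivity

lemma tendsto_gaussTail_atTop : Tendsto gaussTail atTop (𝓝 0) := by
  have h := (intervalIntegral_tendsto_integral_Ioi 0
    integrable_gaussPDF.integrableOn tendsto_id).const_sub (gaussTail 0)
  rw [show ∫ u in Set.Ioi (0 : ℝ), Real.exp (-u ^ 2 / 2) / Real.sqrt (2 * π) = gaussTail 0 from rfl,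
    sub_self] at h
  exact h.congr fun x => (gaussTail_eq_sub x).symm

/-- The Mills ratio bound for the Gaussian tail. -/
lemma mul_gaussTail_le {x : ℝ} (hx : 0 ≤ x) :
    x * gaussTail x ≤ Real.exp (-x ^ 2 / 2) / Real.sqrt (2 * π) := by
  have hd : ∀ u : ℝ, HasDerivAt (fun u : ℝ => -(Real.exp (-u ^ 2 / 2) / Real.sqrt (2 * π)))
      (u * (Real.exp (-u ^ 2 / 2) / Real.sqrt (2 * π))) u := fun u => by
    have h := ((((hasDerivAt_pow 2 u).neg.div_const 2).exp).div_const (Real.sqrt (2 * π))).neg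
    refine h.congr_deriv ?_
    simp only [Nat.cast_ofNat, Pi.neg_apply, Nat.add_one_sub_one, pow_one]
    ring
  have hlim : Tendsto (fun u : ℝ => -(Real.exp (-u ^ 2 / 2) / Real.sqrt (2 * π))) atTop (𝓝 0) := by
    have h1 : Tendsto (fun u : ℝ => -u ^ 2 / 2) atTop atBot := by
      have := (tendsto_pow_atTop (α := ℝ) two_ne_zero).atTop_div_const (r := 2) two_pos
      exact (tendsto_neg_atTop_atBot.comp this).congr fun u => (neg_div 2 (u ^ 2)).symm
    simpa using ((Real.tendsto_exp_atBot.comp h1).div_const (Real.sqrt (2 * π))).neg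
  have hnn : ∀ u ∈ Set.Ioi x, 0 ≤ u * (Real.exp (-u ^ 2 / 2) / Real.sqrt (2 * π)) := fun u hu => by
    have : 0 ≤ u := hx.trans (le_of_lt hu)
    positivity
  have hint := integrableOn_Ioi_deriv_of_nonneg' (fun u _ => hd u) hnn hlim
  have heq := integral_Ioi_of_hasDerivAt_of_nonneg' (fun u _ => hd u) hnn hlim
  rw [zero_sub, neg_neg] at heq
  rw [← heq, gaussTail, ← integral_const_mul]
  exact setIntegral_mono_on (integrable_gaussPDF.integrableOn.const_mul x) hint measurableSet_Ioi
    fun u hu => mul_le_mul_of_nonneg_right (le_of_lt hu) (by positivity)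

lemma hasDerivAt_gaussTail_mul_sqrt (c : ℝ) {l : ℝ} (hl : 0 < l) :
    HasDerivAt (fun l => gaussTail (c * Real.sqrt l))
      (-(c * Real.exp (-c ^ 2 * l / 2) / (2 * Real.sqrt (2 * π * l)))) l := by
  have h := (hasDerivAt_gaussTail (c * Real.sqrt l)).comp l
    ((Real.hasDerivAt_sqrt hl.ne').const_mul c)
  refine h.congr_deriv ?_
  rw [Real.sqrt_mul (by positivity) l, mul_pow, Real.sq_sqrt hl.le, neg_mul]
  have : 0 < Real.sqrt (2 * π) := by positivity
  have : 0 < Real.sqrt l := by positivity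
  field_simp

lemma tendsto_gaussTail_mul_sqrt {c : ℝ} (hc : 0 < c) :
    Tendsto (fun l => gaussTail (c * Real.sqrt l)) atTop (𝓝 0) :=
  tendsto_gaussTail_atTop.comp (Real.tendsto_sqrt_atTop.const_mul_atTop hc)

lemma continuous_gaussTail_mul_sqrt (c : ℝ) : Continuous fun l => gaussTail (c * Real.sqrt l) :=
  continuous_gaussTail.comp (by fun_prop)

lemma sqrt_mul_gaussTail_le {α : ℝ} (hα : 0 < α) (l : ℝ) :
    α * Real.sqrt l * gaussTail (α * Real.sqrt l)
      ≤ Real.exp (-α ^ 2 * Real.sqrt l ^ 2 / 2) / Real.sqrt (2 * π) := by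
  have h := mul_gaussTail_le (x := α * Real.sqrt l) (by positivity)
  rwa [mul_pow, ← neg_mul] at h

lemma excursionDensity_nonneg {α l : ℝ} (hα : 0 < α) (hl : 0 < l) :
    0 ≤ 2 * α * Real.exp (-α ^ 2 * l / 2) / Real.sqrt (2 * π * l)
          - 2 * α ^ 2 * gaussTail (α * Real.sqrt l) := by
  have h := sqrt_mul_gaussTail_le hα l
  have hs : 0 < Real.sqrt l := by positivity
  have hp : 0 < Real.sqrt (2 * π) := by positivity
  rw [Real.sq_sqrt hl.le, le_div_iff₀ hp] at h
  rw [Real.sqrt_mul (by positivity) l, sub_nonneg, le_div_iff₀ (by positivity)]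
  calc _ = 2 * α * (α * Real.sqrt l * gaussTail (α * Real.sqrt l) * Real.sqrt (2 * π)) := by ring
    _ ≤ _ := by gcongr

lemma tendsto_sqrt_mul_exp {α : ℝ} (hα : 0 < α) :
    Tendsto (fun l : ℝ => Real.sqrt l * Real.exp (-α ^ 2 * l / 2)) atTop (𝓝 0) := by
  have h := tendsto_rpow_mul_exp_neg_mul_atTop_nhds_zero (1 / 2) (α ^ 2 / 2) (by positivity)
  refine h.congr fun l => ?_
  rw [Real.sqrt_eq_rpow]
  congr 2
  ring

lemma tendsto_mul_gaussTail {α : ℝ} (hα : 0 < α) :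
    Tendsto (fun l : ℝ => l * gaussTail (α * Real.sqrt l)) atTop (𝓝 0) := by
  have hp : 0 < Real.sqrt (2 * π) := by positivity
  have h := (tendsto_sqrt_mul_exp hα).div_const (α * Real.sqrt (2 * π))
  rw [zero_div] at h
  refine squeeze_zero' ?_ ?_ h
  · filter_upwards [eventually_ge_atTop 0] with l hl
    exact mul_nonneg hl (gaussTail_nonneg _)
  · filter_upwards [eventually_ge_atTop 0] with l hl
    have hb := sqrt_mul_gaussTail_le hα l
    rw [Real.sq_sqrt hl, le_div_iff₀ hp] at hb
    rw [le_div_iff₀ (by positivity)]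
    calc _ = Real.sqrt l * (α * Real.sqrt l * gaussTail (α * Real.sqrt l) * Real.sqrt (2 * π)) := by
          nth_rewrite 1 [← Real.mul_self_sqrt hl]
          ring
      _ ≤ _ := by gcongr

lemma integral_excursionDensity {α : ℝ} (hα : 0 < α) :
    ∫ l in Set.Ioi (0:ℝ),
        (2 * α * Real.exp (-α ^ 2 * l / 2) / Real.sqrt (2 * π * l)
          - 2 * α ^ 2 * gaussTail (α * Real.sqrt l)) = 1 := by
  have hp : 0 < Real.sqrt (2 * π) := by positivity
  have hcont := continuous_gaussTail_mul_sqrt α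
  have key := integral_Ioi_of_hasDerivAt_of_nonneg (a := 0) (l := 0)
    (g := fun l => -(2 * α ^ 2) * (l * gaussTail (α * Real.sqrt l))
      + 2 * α / Real.sqrt (2 * π) * (Real.sqrt l * Real.exp (-α ^ 2 * l / 2))
      - 2 * gaussTail (α * Real.sqrt l))
    (g' := fun l => 2 * α * Real.exp (-α ^ 2 * l / 2) / Real.sqrt (2 * π * l)
          - 2 * α ^ 2 * gaussTail (α * Real.sqrt l))
    (by fun_prop) ?_ (fun l hl => excursionDensity_nonneg hα hl) ?_
  · rw [key]
    simp [gaussTail_zero]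
  · intro l hl
    have hl : 0 < l := hl
    have hs : 0 < Real.sqrt l := by positivity
    have hΦ := hasDerivAt_gaussTail_mul_sqrt α hl
    have hexp : HasDerivAt (fun l : ℝ => Real.exp (-α ^ 2 * l / 2))
        (Real.exp (-α ^ 2 * l / 2) * (-α ^ 2 * 1 / 2)) l :=
      (((hasDerivAt_id l).const_mul (-α ^ 2)).div_const 2).exp
    refine (((((hasDerivAt_id l).mul hΦ).const_mul (-(2 * α ^ 2))).add
      (((Real.hasDerivAt_sqrt hl.ne').mul hexp).const_mul (2 * α / Real.sqrt (2 * π)))).sub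
      (hΦ.const_mul 2)).congr_deriv ?_
    rw [Real.sqrt_mul (by positivity) l]
    obtain ⟨r, hr⟩ : ∃ r, r = Real.sqrt l := ⟨_, rfl⟩
    have hl2 : l = r ^ 2 := by rw [hr, Real.sq_sqrt hl.le]
    simp only [id]
    rw [← hr] at hs ⊢
    generalize Real.exp (-α ^ 2 * l / 2) = E
    generalize gaussTail (α * r) = T
    subst hl2
    field_simp
    ring
  · simpa using (((tendsto_mul_gaussTail hα).const_mul (-(2 * α ^ 2))).add
      ((tendsto_sqrt_mul_exp hα).const_mul (2 * α / Real.sqrt (2 * π)))).sub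
      ((tendsto_gaussTail_mul_sqrt hα).const_mul 2)

lemma integral_exp_mul_excursionDensity {α lam : ℝ} (hα : 0 < α) (hlam : 0 < lam) :
    ∫ l in Set.Ioi (0:ℝ), Real.exp (-lam * l) *
        (2 * α * Real.exp (-α ^ 2 * l / 2) / Real.sqrt (2 * π * l)
          - 2 * α ^ 2 * gaussTail (α * Real.sqrt l))
      = 2 * α / (α + Real.sqrt (2 * lam + α ^ 2)) := by
  obtain ⟨s, hs⟩ : ∃ s, s = Real.sqrt (2 * lam + α ^ 2) := ⟨_, rfl⟩
  have hs0 : 0 < s := by rw [hs]; positivity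
  have hs2 : s ^ 2 = 2 * lam + α ^ 2 := by rw [hs, Real.sq_sqrt (by positivity)]
  rw [← hs]
  have hcα := continuous_gaussTail_mul_sqrt α
  have hcs := continuous_gaussTail_mul_sqrt s
  have key := integral_Ioi_of_hasDerivAt_of_nonneg (a := 0) (l := 0)
    (g := fun l => 2 * α ^ 2 / lam * (Real.exp (-lam * l) * gaussTail (α * Real.sqrt l))
      - (4 * α / s + 2 * α ^ 3 / (lam * s)) * gaussTail (s * Real.sqrt l))
    (g' := fun l => Real.exp (-lam * l) *
        (2 * α * Real.exp (-α ^ 2 * l / 2) / Real.sqrt (2 * π * l)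
          - 2 * α ^ 2 * gaussTail (α * Real.sqrt l)))
    (by fun_prop) ?_
    (fun l hl => mul_nonneg (Real.exp_pos _).le (excursionDensity_nonneg hα hl)) ?_
  · rw [key]
    simp only [Real.sqrt_zero, mul_zero, gaussTail_zero, Real.exp_zero]
    have hlam' : lam = (s ^ 2 - α ^ 2) / 2 := by linarith
    have hne : s ^ 2 - α ^ 2 ≠ 0 := by linarith
    rw [hlam']
    field_simp
    ring
  · intro l hl
    have hl : 0 < l := hl
    have hexp : HasDerivAt (fun l : ℝ => Real.exp (-lam * l))
        (Real.exp (-lam * l) * (-lam * 1)) l :=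
      ((hasDerivAt_id l).const_mul (-lam)).exp
    refine (((hexp.mul (hasDerivAt_gaussTail_mul_sqrt α hl)).const_mul (2 * α ^ 2 / lam)).sub
      ((hasDerivAt_gaussTail_mul_sqrt s hl).const_mul (4 * α / s + 2 * α ^ 3 / (lam * s)))).congr_deriv ?_
    have hE : Real.exp (-s ^ 2 * l / 2) = Real.exp (-lam * l) * Real.exp (-α ^ 2 * l / 2) := by
      rw [← Real.exp_add, hs2]
      congr 1
      ring
    have hr : 0 < Real.sqrt (2 * π * l) := by positivity
    rw [hE]
    field_simp
    ring
  · have hE : Tendsto (fun l : ℝ => Real.exp (-lam * l)) atTop (𝓝 0) :=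
      Real.tendsto_exp_atBot.comp (tendsto_id.const_mul_atTop_of_neg (neg_lt_zero.2 hlam))
    simpa using ((hE.mul (tendsto_gaussTail_mul_sqrt hα)).const_mul (2 * α ^ 2 / lam)).sub
      ((tendsto_gaussTail_mul_sqrt hs0).const_mul (4 * α / s + 2 * α ^ 3 / (lam * s)))

/-- For driftless Brownian motion: the function
`l ↦ 2α e^{−α² l/2}/√(2π l) − 2α² Φ̄(α √l)` on `(0, ∞)` is a probability density
(it is nonnegative and integrates to `1`) whose Laplace transform is
`λ ↦ 2α/(α + √(2λ + α²)) = 4α/(2α + 2√(2λ + α²))`. -/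
theorem driftless_excursion_length_density (α lam : ℝ) (hα : 0 < α) (hlam : 0 ≤ lam) :
    (∫ l in Set.Ioi (0:ℝ), Real.exp (-lam * l) *
        (2 * α * Real.exp (-α ^ 2 * l / 2) / Real.sqrt (2 * π * l)
          - 2 * α ^ 2 * gaussTail (α * Real.sqrt l))
      = 2 * α / (α + Real.sqrt (2 * lam + α ^ 2))) ∧
    (∀ l : ℝ, 0 < l →
      0 ≤ 2 * α * Real.exp (-α ^ 2 * l / 2) / Real.sqrt (2 * π * l)
            - 2 * α ^ 2 * gaussTail (α * Real.sqrt l)) ∧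
    (∫ l in Set.Ioi (0:ℝ),
        (2 * α * Real.exp (-α ^ 2 * l / 2) / Real.sqrt (2 * π * l)
          - 2 * α ^ 2 * gaussTail (α * Real.sqrt l)) = 1) ∧
    2 * α / (α + Real.sqrt (2 * lam + α ^ 2))
      = 4 * α / (2 * α + 2 * Real.sqrt (2 * lam + α ^ 2)) := by
  refine ⟨?_, fun l hl => excursionDensity_nonneg hα hl, integral_excursionDensity hα, ?_⟩
  · rcases hlam.eq_or_lt with rfl | hpos
    · simp only [neg_zero, zero_mul, Real.exp_zero, one_mul, mul_zero, zero_add,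
        Real.sqrt_sq hα.le, integral_excursionDensity hα]
      field_simp
      norm_num
    · exact integral_exp_mul_excursionDensity hα hpos
  · have : 0 ≤ Real.sqrt (2 * lam + α ^ 2) := Real.sqrt_nonneg _
    field_simp
    norm_num
end
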